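/- arXiv:2409.20495 — 3 statements merged into one kernel-verified Lean document; each statement's English description precedes it below -/
import Mathlib

section
/- Let G be a finite group acting on a finite nonempty set Ω. Define the incidence matrix M ∈ ℂ^(G × (Ω×Ω)) by M(g,(a,b)) = 1 if g·a = b and M(g,(a,b)) = 0 otherwise. For an irreducible character χ of G define the matrix E_χ ∈ ℂ^(G×G) by E_χ(x,y) = (χ(e)/|G|)·χ(x⁻¹y), where e is the identity of G. Then the column space of M (the range of the linear map ℂ^(Ω×Ω) → ℂ^G given by v ↦ Mv) equals the sum (supremum), taken over all irreducible characters χ of G with ⟨ξ,χ⟩ ≠ 0, of the column spaces of the matrices E_χ, where ξ is the permutation character of G on Ω. -/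
open CategoryTheory

namespace ColspAux

/-- The permutation representation on functions. -/
noncomputable def permRep (G Ω : Type) [Group G] [MulAction G Ω] :
    Representation ℂ G (Ω → ℂ) where
  toFun g := LinearMap.funLeft ℂ ℂ (fun ω : Ω => g⁻¹ • ω)
  map_one' := by ext; simp [LinearMap.funLeft]
  map_mul' x y := by ext; simp [LinearMap.funLeft, mul_smul]

lemma permRep_apply {G Ω : Type} [Group G] [MulAction G Ω] (g : G) (f : Ω → ℂ) (ω : Ω) :
    permRep G Ω g f ω = f (g⁻¹ • ω) := rfl

lemma trace_permRep_comp {G Ω : Type} [Group G] [Fintype Ω] [DecidableEq Ω] [MulAction G Ω]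
    (g : G) (X : (Ω → ℂ) →ₗ[ℂ] (Ω → ℂ)) :
    LinearMap.trace ℂ _ (permRep G Ω g ∘ₗ X) =
      ∑ ω : Ω, X (Pi.single ω 1) (g⁻¹ • ω) := by
  rw [LinearMap.trace_eq_matrix_trace ℂ (Pi.basisFun ℂ Ω), Matrix.trace]
  refine Finset.sum_congr rfl fun ω _ => ?_
  simp [LinearMap.toMatrix_apply, permRep_apply]

lemma char_permRep {G Ω : Type} [Group G] [Fintype Ω] [DecidableEq Ω] [MulAction G Ω] (g : G) :
    (permRep G Ω).character g = Fintype.card {ω : Ω // g • ω = ω} := by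
  have := trace_permRep_comp (Ω := Ω) g LinearMap.id
  rw [LinearMap.comp_id] at this
  rw [Representation.character, this, Fintype.card_subtype]
  simp only [LinearMap.id_apply, Pi.single_apply, Finset.sum_boole]
  congr 2
  ext ω
  simp only [Finset.mem_filter, Finset.mem_univ, true_and]
  rw [inv_smul_eq_iff, eq_comm]

/-- Burnside: group elements span the endomorphisms of an irreducible representation. -/
lemma exists_comb {G W : Type} [Group G] [Fintype G] [AddCommGroup W] [Module ℂ W]
    [FiniteDimensional ℂ W] (ρ : Representation ℂ G W) [ρ.IsIrreducible] (X : W →ₗ[ℂ] W) :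
    ∃ c : G → ℂ, ∑ y, c y • ρ y = X := by
  let R := MonoidAlgebra ℂ G
  let N := ρ.asModule
  have hb := IsSimpleModule.algebraMap_end_bijective_of_isAlgClosed (A := R) (V := N) ℂ
  let f : Module.End (Module.End R N) N :=
    { toFun := fun n => ρ.asModuleEquiv.symm (X (ρ.asModuleEquiv n))
      map_add' := by intro a b; simp
      map_smul' := by
        intro a b
        obtain ⟨c, rfl⟩ := hb.2 a
        simp [Module.algebraMap_end_apply] }
  have hs : (⊤ : Submodule ℂ N).FG := Module.Finite.fg_top
  obtain ⟨s, hs⟩ := hs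
  obtain ⟨r, hr⟩ := jacobson_density (R := R) (M := N) f s
  have key : ρ.asAlgebraHom r = X := by
    apply LinearMap.ext
    intro w
    have hw : ρ.asModuleEquiv.symm w ∈ (⊤ : Submodule ℂ N) := trivial
    rw [← hs] at hw
    have : ∀ n ∈ Submodule.span ℂ (s : Set N),
        ρ.asAlgebraHom r (ρ.asModuleEquiv n) = X (ρ.asModuleEquiv n) := by
      intro n hn
      induction hn using Submodule.span_induction with
      | mem m hm =>
        have := hr m hm
        rw [← Representation.asModuleEquiv_map_smul, ← this]
        simp [f]
      | zero => simp
      | add _ _ _ _ h₁ h₂ => simp only [map_add, h₁, h₂]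
      | smul g _ _ h => simp only [map_smul, h]
    simpa using this _ hw
  refine ⟨fun y => r.coeff y, ?_⟩
  rw [← key, Representation.asAlgebraHom_def, MonoidAlgebra.lift_apply, Finsupp.sum_fintype]
  intro i
  exact zero_smul ℂ (ρ i)

lemma coeff_mem {G W : Type} [Group G] [Fintype G] [AddCommGroup W] [Module ℂ W]
    [FiniteDimensional ℂ W] (ρ : Representation ℂ G W) [ρ.IsIrreducible]
    (φ : W →ₗ[ℂ] ℂ) (v : W) :
    (fun x : G => φ (ρ x⁻¹ v)) ∈ LinearMap.range (Matrix.of fun x y : G =>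
          (ρ.character 1 / (Fintype.card G : ℂ)) * ρ.character (x⁻¹ * y)).mulVecLin := by
  obtain ⟨c, hc⟩ := exists_comb ρ (LinearMap.toSpanSingleton ℂ W v ∘ₗ φ)
  have hd : ρ.character 1 ≠ 0 := by
    rw [Representation.char_one]
    have : Nontrivial ρ.asModule := IsSimpleModule.nontrivial (MonoidAlgebra ℂ G) _
    have : Nontrivial W := this
    exact_mod_cast Module.finrank_pos.ne'
  have hG : (Fintype.card G : ℂ) ≠ 0 := by exact_mod_cast Fintype.card_ne_zero
  refine ⟨fun y => (ρ.character 1 / (Fintype.card G : ℂ))⁻¹ * c y, ?_⟩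
  ext x
  have h1 : LinearMap.trace ℂ W (ρ x⁻¹ ∘ₗ (LinearMap.toSpanSingleton ℂ W v ∘ₗ φ)) =
      φ (ρ x⁻¹ v) := by
    rw [← LinearMap.comp_assoc, LinearMap.trace_comp_comm']
    rw [LinearMap.trace_eq_matrix_trace ℂ (Module.Basis.singleton Unit ℂ)]
    simp [Matrix.trace, LinearMap.toMatrix_apply]
  rw [← h1, ← hc]
  simp only [Matrix.mulVecLin_apply, Matrix.mulVec, dotProduct, Matrix.of_apply]
  have : ρ x⁻¹ ∘ₗ ∑ y, c y • ρ y = ∑ y, c y • ρ (x⁻¹ * y) := by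
    ext w; simp
  rw [this, map_sum]
  refine Finset.sum_congr rfl fun y _ => ?_
  rw [map_smul, Representation.character, Representation.character] at *
  simp only [smul_eq_mul]
  field_simp

lemma simple_of {G W : Type} [Group G] [Fintype G] [AddCommGroup W] [Module ℂ W]
    [FiniteDimensional ℂ W] (ρ : Representation ℂ G W) [ρ.IsIrreducible] :
    Simple (FDRep.of ρ) := by
  have := invertibleOfNonzero (NeZero.ne (Nat.card G : ℂ))
  rw [FDRep.simple_iff_char_is_norm_one]
  have h := Representation.char_orthonormal ρ ρ
  rw [if_pos ⟨Representation.Equiv.refl ρ⟩, inv_mul_eq_one₀ (NeZero.ne _)] at h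
  exact h.symm

/-- The inner product condition. -/
lemma cond_iff {G Ω : Type} [Group G] [Fintype G] [Fintype Ω]
    [DecidableEq Ω] [MulAction G Ω] (ξ : G → ℂ)
    (hξ : ∀ g, ξ g = Fintype.card {ω : Ω // g • ω = ω}) (V : FDRep ℂ G) :
    (1 / (Fintype.card G : ℂ)) * ∑ g : G, ξ g * star (V.character g) ≠ 0 ↔
      (Nat.card G : ℂ)⁻¹ * ∑ g : G, (permRep G Ω).character g * V.character g⁻¹ ≠ 0 := by
  have hinv : ∀ g, ξ g⁻¹ = ξ g := by
    intro g
    rw [hξ, hξ]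
    congr 1
    refine Fintype.card_congr (Equiv.subtypeEquivRight fun ω => ?_)
    rw [inv_smul_eq_iff, eq_comm]
  have hs : ∀ g, star (ξ g) = ξ g := by
    intro g; rw [hξ]; simp
  have e : ∑ g : G, (permRep G Ω).character g * V.character g⁻¹ =
      star (∑ g : G, ξ g * star (V.character g)) := by
    rw [star_sum]
    refine Fintype.sum_equiv (Equiv.inv G) _ _ fun g => ?_
    simp only [star_mul', star_star, hs, Equiv.inv_apply, hinv]
    rw [char_permRep, hξ]
  rw [e]
  have hG : (Fintype.card G : ℂ) ≠ 0 := by exact_mod_cast Fintype.card_ne_zero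
  rw [Nat.card_eq_fintype_card]
  refine not_congr ?_
  rw [mul_eq_zero_iff_left (one_div_ne_zero hG), mul_eq_zero_iff_left (inv_ne_zero hG),
    star_eq_zero]

lemma part1 {G Ω : Type} [Group G] [Fintype G] [Fintype Ω]
    [DecidableEq Ω] [MulAction G Ω]
    (M : Matrix G (Ω × Ω) ℂ)
    (hM : ∀ g a b, M g (a, b) = if g • a = b then 1 else 0)
    (V : FDRep ℂ G) [Simple V]
    (h : (Nat.card G : ℂ)⁻¹ * ∑ g : G, (permRep G Ω).character g * V.character g⁻¹ ≠ 0) :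
    LinearMap.range (Matrix.of fun x y : G =>
          (V.character 1 / (Fintype.card G : ℂ)) * V.character (x⁻¹ * y)).mulVecLin ≤
      LinearMap.range M.mulVecLin := by
  have := invertibleOfNonzero (NeZero.ne (Nat.card G : ℂ))
  have h2 := FDRep.scalar_product_char_eq_finrank_equivariant V (FDRep.of (permRep G Ω))
  have h3 : Module.finrank ℂ (V ⟶ FDRep.of (permRep G Ω)) ≠ 0 := by
    intro h0
    rw [h0] at h2
    exact h (h2.trans (by simp))
  obtain ⟨f, hf⟩ := (Module.finrank_pos_iff_exists_ne_zero (R := ℂ)).mp (Nat.pos_of_ne_zero h3)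
  have hmono : Mono f := mono_of_nonzero_from_simple hf
  have hm2 : Mono ((forget₂ (FDRep ℂ G) (Rep ℂ G)).map f) := inferInstance
  rw [Rep.mono_iff_injective] at hm2
  let F : V →ₗ[ℂ] (Ω → ℂ) := ((forget₂ (FDRep ℂ G) (Rep ℂ G)).map f).hom.toLinearMap
  have hF : Function.Injective F := hm2
  have hFc : ∀ g, F ∘ₗ V.ρ g = permRep G Ω g ∘ₗ F := fun g =>
    ((forget₂ (FDRep ℂ G) (Rep ℂ G)).map f).hom.isIntertwining' g
  obtain ⟨L, hL⟩ := LinearMap.exists_leftInverse_of_injective F (LinearMap.ker_eq_bot.mpr hF)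
  rw [Matrix.range_mulVecLin, Submodule.span_le]
  rintro _ ⟨y, rfl⟩
  have key : ∀ x, V.character (x⁻¹ * y) =
      ∑ ω : Ω, F (L (Pi.single ω 1)) ((x⁻¹ * y)⁻¹ • ω) := by
    intro x
    have := trace_permRep_comp (Ω := Ω) (x⁻¹ * y) (F ∘ₗ L)
    rw [← LinearMap.comp_assoc, ← hFc, LinearMap.trace_comp_comm', ← LinearMap.comp_assoc, hL,
      LinearMap.id_comp] at this
    exact this
  refine ⟨fun p => V.character 1 / (Fintype.card G : ℂ) *
    F (L (Pi.single p.1 1)) (y⁻¹ • p.2), ?_⟩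
  ext x
  simp only [Matrix.mulVecLin_apply, Matrix.mulVec, dotProduct, Matrix.col_apply, Matrix.of_apply,
    key, Fintype.sum_prod_type, hM, Finset.mul_sum]
  refine Finset.sum_congr rfl fun ω _ => ?_
  simp [mul_smul]

lemma irr_of_simple {G W : Type} [Group G] [AddCommGroup W] [Module ℂ W]
    (P : Representation ℂ G W) (S : Submodule (MonoidAlgebra ℂ G) P.asModule)
    (hS : IsSimpleModule (MonoidAlgebra ℂ G) S) :
    Representation.IsIrreducible (Subrepresentation.ofSubmodule' S).toRepresentation := by
  rw [Representation.irreducible_iff_isSimpleModule_asModule]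
  let σ := (Subrepresentation.ofSubmodule' S).toRepresentation
  let e : σ.asModule ≃ₗ[MonoidAlgebra ℂ G] S :=
    { toFun := fun w => ⟨P.asModuleEquiv.symm (σ.asModuleEquiv w).1, (σ.asModuleEquiv w).2⟩
      invFun := fun s => σ.asModuleEquiv.symm ⟨P.asModuleEquiv s.1, s.2⟩
      left_inv := fun _ => rfl
      right_inv := fun _ => rfl
      map_add' := fun _ _ => rfl
      map_smul' := by
        intro r w
        apply Subtype.ext
        simp only [RingHom.id_apply, Submodule.coe_smul]
        induction r using MonoidAlgebra.induction_on with
        | of g =>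
          rw [MonoidAlgebra.of_apply, Representation.single_smul, Representation.single_smul,
            one_smul, one_smul]
          rfl
        | add a b ha hb =>
          rw [add_smul, add_smul, ← ha, ← hb]
          rfl
        | smul c a ha =>
          rw [smul_assoc, smul_assoc, ← ha]
          rfl }
  exact IsSimpleModule.congr e

lemma part2 {G Ω : Type} [Group G] [Fintype G] [Fintype Ω]
    [DecidableEq Ω] [MulAction G Ω] (T : Submodule ℂ (G → ℂ))
    (hT : ∀ (V : FDRep ℂ G) (_ : Simple V)
      (_ : (Nat.card G : ℂ)⁻¹ * ∑ g : G, (permRep G Ω).character g * V.character g⁻¹ ≠ 0),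
       LinearMap.range (Matrix.of fun x y : G =>
          (V.character 1 / (Fintype.card G : ℂ)) * V.character (x⁻¹ * y)).mulVecLin ≤ T)
    (φ : (Ω → ℂ) →ₗ[ℂ] ℂ) (v : Ω → ℂ) :
    (fun x : G => φ (permRep G Ω x⁻¹ v)) ∈ T := by
  have hinv := invertibleOfNonzero (NeZero.ne (Nat.card G : ℂ))
  let P := permRep G Ω
  let R := MonoidAlgebra ℂ G
  have hv : P.asModuleEquiv.symm v ∈ (⊤ : Submodule R P.asModule) := trivial
  rw [← IsSemisimpleModule.sSup_simples_eq_top, sSup_eq_iSup'] at hv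
  suffices H : ∀ n : P.asModule, n ∈ ⨆ a : { m : Submodule R P.asModule | IsSimpleModule R m },
      (a : Submodule R P.asModule) →
      (fun x : G => φ (P x⁻¹ (P.asModuleEquiv n))) ∈ T by
    simpa using H _ hv
  intro n hn
  induction hn using Submodule.iSup_induction' with
  | zero => simp only [map_zero]; exact T.zero_mem
  | add a b _ _ ha hb =>
    simp only [map_add]
    exact T.add_mem ha hb
  | mem S n hn =>
    obtain ⟨S, hS⟩ := S
    have hS : IsSimpleModule R S := hS
    let τ : Subrepresentation P := Subrepresentation.ofSubmodule' S
    let σ : Representation ℂ G τ.toSubmodule := τ.toRepresentation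
    have hirr : Representation.IsIrreducible σ := irr_of_simple P S hS
    let ι : τ.toSubmodule →ₗ[ℂ] (Ω → ℂ) := τ.toSubmodule.subtype
    have hι : Function.Injective ι := τ.toSubmodule.injective_subtype
    have hc : ∀ g w, ι (σ g w) = P g (ι w) := fun g w => rfl
    have hsim := simple_of σ
    have hne : (Nat.card G : ℂ)⁻¹ * ∑ g : G, P.character g * σ.character g⁻¹ ≠ 0 := by
      rw [Representation.card_inv_mul_sum_char_mul_char_eq_finrank]
      let f : Representation.IntertwiningMap σ P :=
        { ι with isIntertwining' := fun g => LinearMap.ext (hc g) }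
      have hf : f ≠ 0 := by
        have : Nontrivial S := IsSimpleModule.nontrivial R S
        have : Nontrivial τ.toSubmodule := this
        obtain ⟨s, hs⟩ := exists_ne (0 : τ.toSubmodule)
        intro h0
        apply hs
        apply hι
        have : f s = 0 := by rw [h0]; rfl
        rw [map_zero]
        exact this
      have : 0 < Module.finrank ℂ (Representation.IntertwiningMap σ P) := by
        exact (Module.finrank_pos_iff_exists_ne_zero (R := ℂ)).mpr ⟨f, hf⟩
      exact_mod_cast this.ne'
    refine hT (FDRep.of σ) hsim hne ?_
    have := coeff_mem σ (φ ∘ₗ ι) ⟨P.asModuleEquiv n, hn⟩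
    exact this

end ColspAux

open ColspAux in
/-- **Column space of the incidence matrix of a group action.**
Let `G` be a finite group acting on a finite nonempty set `Ω`, let `M` be the incidence
matrix of the action, indexed by `G × (Ω × Ω)`, with `M g (a,b) = 1` iff `g • a = b`.
For an irreducible character `χ` (the character of a simple finite-dimensional complex
representation `V`), let `E_χ` be the `G × G` matrix with entries
`(χ(1)/|G|)·χ(x⁻¹y)`.  Then the column space of `M` (the range of `v ↦ M *ᵥ v`) is the
sum of the column spaces of the matrices `E_χ` over all irreducible characters `χ`
having nonzero inner product with the permutation character `ξ` of `G` on `Ω`. -/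
theorem colsp_incidence_matrix {G Ω : Type} [Group G] [Fintype G] [Fintype Ω] [Nonempty Ω]
    [DecidableEq Ω] [MulAction G Ω]
    (M : Matrix G (Ω × Ω) ℂ)
    (hM : ∀ g a b, M g (a, b) = if g • a = b then 1 else 0)
    (ξ : G → ℂ)
    (hξ : ∀ g, ξ g = Fintype.card {ω : Ω // g • ω = ω}) :
    LinearMap.range M.mulVecLin =
      ⨆ (V : FDRep ℂ G) (_ : Simple V)
        (_ : (1 / (Fintype.card G : ℂ)) * ∑ g : G, ξ g * star (V.character g) ≠ 0),
        LinearMap.range (Matrix.of fun x y : G =>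
          (V.character 1 / (Fintype.card G : ℂ)) * V.character (x⁻¹ * y)).mulVecLin := by
  apply le_antisymm
  · rw [Matrix.range_mulVecLin, Submodule.span_le]
    rintro _ ⟨⟨a, b⟩, rfl⟩
    have := part2 (G := G) (Ω := Ω) (⨆ (V : FDRep ℂ G) (_ : Simple V)
        (_ : (1 / (Fintype.card G : ℂ)) * ∑ g : G, ξ g * star (V.character g) ≠ 0),
        LinearMap.range (Matrix.of fun x y : G =>
          (V.character 1 / (Fintype.card G : ℂ)) * V.character (x⁻¹ * y)).mulVecLin) (fun V hV h => le_iSup_of_le V <| le_iSup_of_le hV <|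
      le_iSup_of_le ((cond_iff ξ hξ V).mpr h) le_rfl) (LinearMap.proj a) (Pi.single b 1)
    refine (congrArg (fun z => z ∈ _) ?_).mpr this
    ext x
    simp [Matrix.col_apply, hM, permRep_apply, Pi.single_apply]
  · refine iSup_le fun V => iSup_le fun hV => iSup_le fun h => ?_
    exact part1 M hM V ((cond_iff ξ hξ V).mp h)
end

section
/- Let G be a finite group acting transitively on a finite nonempty set Ω with permutation character ξ, and let Y be a nonempty subset of G. Then Y is transitive on Ω if and only if Σ_{x,y ∈ Y} χ(x⁻¹y) = 0 for every irreducible character χ of G that is not the trivial character (the constant function 1) and satisfies ⟨ξ,χ⟩ ≠ 0. -/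
open CategoryTheory

namespace TransAux

open Module Representation

/-- The permutation representation on `EuclideanSpace ℂ Ω`. -/
noncomputable def permRep (G Ω : Type) [Group G] [MulAction G Ω] :
    Representation ℂ G (EuclideanSpace ℂ Ω) where
  toFun g :=
    { toFun := fun f => WithLp.toLp 2 fun ω => f (g⁻¹ • ω)
      map_add' := fun f h => by ext; simp
      map_smul' := fun c f => by ext; simp }
  map_one' := by ext; simp
  map_mul' g h := by
    apply LinearMap.ext; intro f; ext ω; simp [mul_smul]

section
variable {G Ω : Type} [Group G] [MulAction G Ω]

@[simp] lemma permRep_apply (g : G) (f : EuclideanSpace ℂ Ω) (ω : Ω) :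
    permRep G Ω g f ω = f (g⁻¹ • ω) := rfl

variable [Fintype Ω]

lemma permRep_sum (g : G) (f : EuclideanSpace ℂ Ω) :
    ∑ ω, permRep G Ω g f ω = ∑ ω, f ω := by
  simp only [permRep_apply]
  exact Equiv.sum_comp (MulAction.toPerm g⁻¹) (fun ω => f ω)

lemma permRep_inner (g : G) (u v : EuclideanSpace ℂ Ω) :
    inner ℂ (permRep G Ω g u) (permRep G Ω g v) = inner ℂ u v := by
  simp only [PiLp.inner_apply, permRep_apply]
  exact Equiv.sum_comp (MulAction.toPerm g⁻¹) (fun ω => inner ℂ (u ω) (v ω))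

lemma permRep_inner_left (g : G) (u v : EuclideanSpace ℂ Ω) :
    inner ℂ (permRep G Ω g u) v = inner ℂ u (permRep G Ω g⁻¹ v) := by
  rw [← permRep_inner g⁻¹, ← Module.End.mul_apply, ← map_mul]
  simp

lemma permRep_character [DecidableEq Ω] (g : G) :
    (permRep G Ω).character g = Fintype.card {ω : Ω // g • ω = ω} := by
  unfold Representation.character
  rw [LinearMap.trace_eq_sum_inner _ (EuclideanSpace.basisFun Ω ℂ), Fintype.card_subtype,
    Finset.card_filter]
  push_cast
  refine Finset.sum_congr rfl fun ω _ => ?_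
  have : (ω = g • ω) = (g • ω = ω) := propext eq_comm
  simp [EuclideanSpace.inner_single_left, inv_smul_eq_iff, this]

lemma permRep_single [DecidableEq Ω] (g : G) (a : Ω) :
    permRep G Ω g (EuclideanSpace.single a 1) = EuclideanSpace.single (g • a) 1 := by
  ext ω
  simp [inv_smul_eq_iff]

/-- Nonvanishing of the inner product gives a nonzero intertwiner and conversely. -/
lemma inner_ne_zero_iff [Fintype G] [DecidableEq Ω] (ξ : G → ℂ)
    (hξ : ∀ g, ξ g = Fintype.card {ω : Ω // g • ω = ω})
    {V : Type} [AddCommGroup V] [Module ℂ V] [FiniteDimensional ℂ V]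
    (ρ : Representation ℂ G V) :
    (1 / (Fintype.card G : ℂ)) * ∑ g : G, ξ g * star (ρ.character g) ≠ 0 ↔
      ∃ f : IntertwiningMap ρ (permRep G Ω), f ≠ 0 := by
  have : Invertible (Nat.card G : ℂ) := invertibleOfNonzero (by simp)
  have h1 : (∑ g : G, ξ g * star (ρ.character g)) =
      star (∑ g : G, (permRep G Ω).character g * ρ.character g⁻¹) := by
    rw [star_sum, ← Equiv.sum_comp (Equiv.inv G)]
    refine Finset.sum_congr rfl fun g _ => ?_
    have : ξ g⁻¹ = (permRep G Ω).character g := by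
      rw [hξ, permRep_character]
      congr 1
      apply Fintype.card_congr
      refine Equiv.subtypeEquivRight fun ω => ?_
      rw [inv_smul_eq_iff, eq_comm]
    simp only [Equiv.inv_apply, this, star_mul', inv_inv]
    congr 1
    rw [permRep_character]; simp
  have h2 := card_inv_mul_sum_char_mul_char_eq_finrank ρ (permRep G Ω)
  have hG : (Nat.card G : ℂ)⁻¹ ≠ 0 := by simp
  have : FiniteDimensional ℂ (IntertwiningMap ρ (permRep G Ω)) :=
    Module.Finite.equiv (invariantsEquivIntertwiningMap ρ (permRep G Ω))
  rw [h1, ← Nat.card_eq_fintype_card, one_div, mul_ne_zero_iff, star_ne_zero]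
  have h3 : (∑ g : G, (permRep G Ω).character g * ρ.character g⁻¹) ≠ 0 ↔
      (finrank ℂ (IntertwiningMap ρ (permRep G Ω)) : ℂ) ≠ 0 := by
    rw [← h2, mul_ne_zero_iff]; simp
  rw [h3, Nat.cast_ne_zero, ← Nat.pos_iff_ne_zero, Module.finrank_pos_iff]
  constructor
  · rintro ⟨-, h⟩
    exact exists_ne 0
  · rintro ⟨f, hf⟩
    exact ⟨hG, nontrivial_of_ne f 0 hf⟩

end

lemma simple_of_irreducible {G : Type} [Group G] [Fintype G]
    {V : Type} [AddCommGroup V] [Module ℂ V] [FiniteDimensional ℂ V]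
    (ρ : Representation ℂ G V) [IsIrreducible ρ] : Simple (FDRep.of ρ) := by
  have : Invertible (Nat.card G : ℂ) := invertibleOfNonzero (by simp)
  rw [FDRep.simple_iff_char_is_norm_one]
  have h := card_inv_mul_sum_char_mul_char_eq_finrank ρ ρ
  rw [IsIrreducible.finrank_intertwiningMap_self] at h
  have hG : (Nat.card G : ℂ) ≠ 0 := by simp
  have h' : ∑ g : G, ρ.character g * ρ.character g⁻¹ = Nat.card G := by
    field_simp at h
    simpa using h
  exact h'

lemma invariant_of_simple {G : Type} [Group G] (V : FDRep ℂ G) [Simple V]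
    (U : Subrepresentation V.ρ) : U.toSubmodule = ⊥ ∨ U.toSubmodule = ⊤ := by
  let i : FDRep.of U.toRepresentation ⟶ V :=
    ⟨InducedCategory.homMk (ModuleCat.ofHom U.toSubmodule.subtype), fun g => by
      ext1
      rfl⟩
  have hi : Mono i := by
    refine ⟨fun {Z} a b hab => ?_⟩
    ext z
    have := congrArg (fun t => t.hom.hom.hom z) hab
    exact this
  by_cases h0 : i = 0
  · left
    rw [eq_bot_iff]
    intro u hu
    have := congrArg (fun t => t.hom.hom.hom ⟨u, hu⟩) h0
    exact this
  · right
    have := isIso_of_mono_of_nonzero h0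
    rw [eq_top_iff]
    intro v _
    have h := congrArg (fun t => t.hom.hom.hom v) (IsIso.inv_hom_id i)
    have h2 : ((inv i).hom.hom.hom v : U.toSubmodule).1 = v := h
    rw [← h2]
    exact ((inv i).hom.hom.hom v : U.toSubmodule).2

section
variable {G Ω : Type} [Group G] [MulAction G Ω] [Fintype G] [Fintype Ω]

lemma forward [DecidableEq Ω]
    (Y : Finset G) (c : ℕ) (hc : ∀ a b : Ω, (Y.filter fun y => y • a = b).card = c)
    (V : FDRep ℂ G) (hV : Simple V) (h1 : V.character ≠ fun _ => 1)
    (f : IntertwiningMap V.ρ (permRep G Ω)) (hf : f ≠ 0) :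
    ∑ x ∈ Y, ∑ y ∈ Y, V.character (x⁻¹ * y) = 0 := by
  -- the sum functional
  let s : V →ₗ[ℂ] ℂ :=
    { toFun := fun v => ∑ ω, f v ω
      map_add' := fun u v => by simp [Finset.sum_add_distrib]
      map_smul' := fun c v => by simp [Finset.mul_sum] }
  have hs : ∀ g v, s (V.ρ g v) = s v := fun g v => by
    change ∑ ω, f (V.ρ g v) ω = ∑ ω, f v ω
    rw [f.isIntertwining]
    exact permRep_sum g (f v)
  have hker : LinearMap.ker f.toLinearMap = ⊥ := by
    rcases invariant_of_simple V (IntertwiningMap.ker _ _ f) with h | h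
    · exact h
    · exfalso
      apply hf
      apply IntertwiningMap.ext
      exact LinearMap.ker_eq_top.1 h
  have hs0 : s = 0 := by
    rcases invariant_of_simple V ⟨LinearMap.ker s, fun g v hv => by
      rw [LinearMap.mem_ker] at hv ⊢; rw [hs, hv]⟩ with h | h
    · by_contra hs0
      apply h1
      have hinj : Function.Injective s := LinearMap.ker_eq_bot.1 h
      have hρ : ∀ g, V.ρ g = 1 := fun g => LinearMap.ext fun v => hinj (hs g v)
      have hle : finrank ℂ V ≤ 1 := by
        simpa using LinearMap.finrank_le_finrank_of_injective hinj
      have hne : finrank ℂ V ≠ 0 := by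
        intro h0
        apply hs0
        have := finrank_zero_iff.1 h0
        ext v
        rw [Subsingleton.elim v 0]; simp
      have : finrank ℂ V = 1 := by omega
      funext g
      rw [FDRep.character, hρ, LinearMap.trace_one, this]; simp
    · exact LinearMap.ker_eq_top.1 h
  have hA : ∑ y ∈ Y, V.ρ y = 0 := by
    ext v
    apply LinearMap.ker_eq_bot.1 hker
    have : f.toLinearMap ((∑ y ∈ Y, V.ρ y) v) = ∑ y ∈ Y, permRep G Ω y (f v) := by
      rw [LinearMap.sum_apply, map_sum]
      exact Finset.sum_congr rfl fun y _ => IntertwiningMap.isIntertwining _ _ f y v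
    rw [this, LinearMap.zero_apply, map_zero]
    ext b
    have e1 : (∑ y ∈ Y, permRep G Ω y (f v)) b = ∑ y ∈ Y, f v (y⁻¹ • b) := by
      simp
    rw [e1]
    have e2 : ∑ y ∈ Y, f v (y⁻¹ • b) = ∑ a : Ω, ∑ y ∈ Y with y⁻¹ • b = a, f v (y⁻¹ • b) :=
      (Finset.sum_fiberwise _ _ _).symm
    rw [e2]
    have e3 : ∀ a : Ω, ∑ y ∈ Y with y⁻¹ • b = a, f v (y⁻¹ • b) = c * f v a := fun a => by
      rw [Finset.sum_congr rfl (g := fun _ => f v a)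
        (fun y hy => by rw [(Finset.mem_filter.1 hy).2])]
      rw [Finset.sum_const, nsmul_eq_mul, ← hc a b]
      congr 3
      ext y
      simp only [Finset.mem_filter, inv_smul_eq_iff, eq_comm (a := b)]
    simp only [e3]
    rw [← Finset.mul_sum]
    have : s v = 0 := by rw [hs0]; rfl
    change _ * s v = 0
    rw [this, mul_zero]
  refine Finset.sum_eq_zero fun x _ => ?_
  simp only [FDRep.character, map_mul]
  rw [← map_sum, ← Finset.mul_sum, hA, mul_zero, map_zero]

lemma kill_irreducible [DecidableEq Ω] (htrans : MulAction.IsPretransitive G Ω)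
    (ξ : G → ℂ) (hξ : ∀ g, ξ g = Fintype.card {ω : Ω // g • ω = ω}) (Y : Finset G)
    (H : ∀ V : FDRep ℂ G, Simple V → V.character ≠ (fun _ => 1) →
        (1 / (Fintype.card G : ℂ)) * ∑ g : G, ξ g * star (V.character g) ≠ 0 →
        ∑ x ∈ Y, ∑ y ∈ Y, V.character (x⁻¹ * y) = 0)
    (W : Subrepresentation (permRep G Ω)) (hirr : IsIrreducible W.toRepresentation)
    (hW : ∀ w ∈ W.toSubmodule, ∑ ω, w ω = 0) :
    ∀ w ∈ W.toSubmodule, ∑ y ∈ Y, permRep G Ω y w = 0 := by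
  have : Invertible (Nat.card G : ℂ) := invertibleOfNonzero (by simp)
  have hnt : Nontrivial W.toSubmodule := by
    by_contra hn
    rw [not_nontrivial_iff_subsingleton] at hn
    apply bot_ne_top (α := Subrepresentation W.toRepresentation)
    apply Subrepresentation.toSubmodule_injective
    exact Subsingleton.elim _ _
  have hsum := H (FDRep.of W.toRepresentation) (simple_of_irreducible _) (by
    intro h
    have h' : ∀ g, W.toRepresentation.character g = 1 := fun g => congrFun h g
    have h2 := card_inv_mul_sum_char_eq_finrank W.toRepresentation
    simp only [h'] at h2
    have h3 : finrank ℂ (invariants W.toRepresentation) = 1 := by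
      have : (finrank ℂ (invariants W.toRepresentation) : ℂ) = 1 := by
        rw [← h2]; simp
      exact_mod_cast this
    have := Module.nontrivial_of_finrank_pos (R := ℂ) (M := invariants W.toRepresentation)
      (by omega)
    obtain ⟨⟨⟨w, hwW⟩, hw⟩, hne⟩ := exists_ne (0 : invariants W.toRepresentation)
    apply hne
    apply Subtype.ext
    apply Subtype.ext
    change w = 0
    rw [mem_invariants] at hw
    have hw' : ∀ g : G, permRep G Ω g w = w := fun g => congrArg Subtype.val (hw g)
    ext a
    have hconst : ∀ b, w b = w a := fun b => by
      obtain ⟨g, hg⟩ := htrans.exists_smul_eq b a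
      rw [← hg]
      conv_rhs => rw [← hw' g, permRep_apply, inv_smul_smul]
    have hz := hW w hwW
    simp only [hconst] at hz
    rw [Finset.sum_const, Finset.card_univ, nsmul_eq_mul] at hz
    have : Nonempty Ω := ⟨a⟩
    rcases mul_eq_zero.1 hz with h | h
    · exact absurd h (by simp)
    · simpa using h) (by
    refine (inner_ne_zero_iff (Ω := Ω) ξ hξ W.toRepresentation).2
      ⟨⟨W.toSubmodule.subtype, fun g => rfl⟩, ?_⟩
    intro h
    obtain ⟨w, hw⟩ := exists_ne (0 : W.toSubmodule)
    apply hw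
    apply Subtype.ext
    exact congrArg (fun t => IntertwiningMap.toLinearMap t w) h)
  let b := stdOrthonormalBasis ℂ W.toSubmodule
  let A : EuclideanSpace ℂ Ω →ₗ[ℂ] EuclideanSpace ℂ Ω := ∑ y ∈ Y, permRep G Ω y
  have hchar : ∀ x y : G, (FDRep.of W.toRepresentation).character (x⁻¹ * y) =
      ∑ i, inner ℂ (permRep G Ω x (b i : EuclideanSpace ℂ Ω)) (permRep G Ω y (b i)) := by
    intro x y
    change LinearMap.trace ℂ _ (W.toRepresentation (x⁻¹ * y)) = _
    rw [LinearMap.trace_eq_sum_inner _ b]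
    refine Finset.sum_congr rfl fun i _ => ?_
    rw [permRep_inner_left, ← Module.End.mul_apply, ← map_mul]
    rfl
  have hsum' : ∑ i, ‖A (b i)‖ ^ 2 = 0 := by
    have : ((∑ i, ‖A (b i)‖ ^ 2 : ℝ) : ℂ) = 0 := by
      rw [← hsum]
      simp only [hchar]
      rw [Finset.sum_congr rfl fun x _ => Finset.sum_comm, Finset.sum_comm]
      push_cast
      refine Finset.sum_congr rfl fun i _ => ?_
      refine (inner_self_eq_norm_sq_to_K (𝕜 := ℂ) (A (b i))).symm.trans ?_
      simp only [A, LinearMap.sum_apply, sum_inner, inner_sum]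
      exact Finset.sum_comm
    exact_mod_cast this
  have hb : ∀ i, A (b i) = 0 := fun i => by
    have := (Finset.sum_eq_zero_iff_of_nonneg (fun i _ => by positivity)).1 hsum' i
      (Finset.mem_univ i)
    simpa using this
  have hAW : A ∘ₗ W.toSubmodule.subtype = 0 := by
    apply b.toBasis.ext
    intro i
    simpa using hb i
  intro w hw
  have := LinearMap.congr_fun hAW ⟨w, hw⟩
  simpa [A] using this

lemma kill [DecidableEq Ω] (htrans : MulAction.IsPretransitive G Ω)
    (ξ : G → ℂ) (hξ : ∀ g, ξ g = Fintype.card {ω : Ω // g • ω = ω}) (Y : Finset G)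
    (H : ∀ V : FDRep ℂ G, Simple V → V.character ≠ (fun _ => 1) →
        (1 / (Fintype.card G : ℂ)) * ∑ g : G, ξ g * star (V.character g) ≠ 0 →
        ∑ x ∈ Y, ∑ y ∈ Y, V.character (x⁻¹ * y) = 0) (n : ℕ) :
    ∀ (W : Subrepresentation (permRep G Ω)), finrank ℂ W.toSubmodule = n →
    (∀ w ∈ W.toSubmodule, ∑ ω, w ω = 0) →
    ∀ w ∈ W.toSubmodule, ∑ y ∈ Y, permRep G Ω y w = 0 := by
  induction n using Nat.strong_induction_on with
  | _ n ih =>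
  intro W hn hW w hw
  by_cases hex : ∃ U : Subrepresentation (permRep G Ω), U.toSubmodule ≤ W.toSubmodule ∧
      U.toSubmodule ≠ ⊥ ∧ U.toSubmodule ≠ W.toSubmodule
  · obtain ⟨U, hUW, hU0, hU1⟩ := hex
    have hUlt : U.toSubmodule < W.toSubmodule := lt_of_le_of_ne hUW hU1
    let U' : Subrepresentation (permRep G Ω) :=
      ⟨U.toSubmoduleᗮ ⊓ W.toSubmodule, fun g v hv => by
        refine ⟨?_, W.apply_mem_toSubmodule g hv.2⟩
        intro u hu
        have := hv.1 _ (U.apply_mem_toSubmodule g⁻¹ hu)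
        rw [permRep_inner_left] at this
        simpa using this⟩
    have hU'lt : U'.toSubmodule < W.toSubmodule := by
      refine lt_of_le_of_ne inf_le_right fun h => hU0 ?_
      rw [eq_bot_iff]
      intro u hu
      have h2 : u ∈ U'.toSubmodule := h ▸ hUW hu
      have := h2.1 u hu
      simpa using this
    obtain ⟨u, hu, v, hv, rfl⟩ := U.toSubmodule.exists_add_mem_mem_orthogonal w
    have hvW : v ∈ W.toSubmodule := by
      have := W.toSubmodule.sub_mem hw (hUW hu)
      simpa using this
    have r1 := ih _ (hn ▸ Submodule.finrank_lt_finrank_of_lt hUlt) U rfl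
      (fun w hw => hW w (hUW hw)) u hu
    have r2 := ih _ (hn ▸ Submodule.finrank_lt_finrank_of_lt hU'lt) U' rfl
      (fun w hw => hW w hw.2) v ⟨hv, hvW⟩
    simp only [map_add, Finset.sum_add_distrib, r1, r2, add_zero]
  · push Not at hex
    by_cases hbot : W.toSubmodule = ⊥
    · rw [hbot, Submodule.mem_bot] at hw
      simp [hw]
    · refine kill_irreducible htrans ξ hξ Y H W ?_ hW w hw
      have hnt : Nontrivial (Subrepresentation W.toRepresentation) := by
        refine ⟨⊥, ⊤, fun h => hbot ?_⟩
        have h2 : (⊥ : Submodule ℂ W.toSubmodule) = ⊤ := congrArg Subrepresentation.toSubmodule h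
        rw [eq_bot_iff]
        intro x hx
        have : (⟨x, hx⟩ : W.toSubmodule) ∈ (⊥ : Submodule ℂ W.toSubmodule) := h2 ▸ trivial
        simpa using this
      refine { eq_bot_or_eq_top := fun S => ?_ }
      let U : Subrepresentation (permRep G Ω) :=
        ⟨S.toSubmodule.map W.toSubmodule.subtype, fun g v hv => by
          obtain ⟨s, hs, rfl⟩ := hv
          exact ⟨W.toRepresentation g s, S.apply_mem_toSubmodule g hs, rfl⟩⟩
      by_cases hS : U.toSubmodule = ⊥
      · left
        apply Subrepresentation.toSubmodule_injective
        apply Submodule.map_injective_of_injective (Submodule.subtype_injective W.toSubmodule)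
        change U.toSubmodule = Submodule.map _ ⊥
        rw [hS, Submodule.map_bot]
      · right
        have := hex U (Submodule.map_subtype_le _ _) hS
        apply Subrepresentation.toSubmodule_injective
        apply Submodule.map_injective_of_injective (Submodule.subtype_injective W.toSubmodule)
        change U.toSubmodule = Submodule.map _ ⊤
        rw [this, Submodule.map_subtype_top]

lemma backward [Nonempty Ω] [DecidableEq Ω] (htrans : MulAction.IsPretransitive G Ω)
    (ξ : G → ℂ) (hξ : ∀ g, ξ g = Fintype.card {ω : Ω // g • ω = ω})
    (Y : Finset G) (hY : Y.Nonempty)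
    (H : ∀ V : FDRep ℂ G, Simple V → V.character ≠ (fun _ => 1) →
        (1 / (Fintype.card G : ℂ)) * ∑ g : G, ξ g * star (V.character g) ≠ 0 →
        ∑ x ∈ Y, ∑ y ∈ Y, V.character (x⁻¹ * y) = 0) :
    ∃ c : ℕ, 0 < c ∧ ∀ a b : Ω, (Y.filter fun y => y • a = b).card = c := by
  let P0 : Subrepresentation (permRep G Ω) :=
    ⟨{ carrier := {w | ∑ ω, w ω = 0}
       add_mem' := fun {a b} ha hb => by
        simp only [Set.mem_ofPred_eq] at *
        simp [Finset.sum_add_distrib, ha, hb]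
       zero_mem' := by simp
       smul_mem' := fun c x hx => by
        simp only [Set.mem_ofPred_eq] at *
        simp [← Finset.mul_sum, hx] }, fun g v hv => by
        change ∑ ω, _ = _
        rw [permRep_sum]; exact hv⟩
  have hk := kill htrans ξ hξ Y H _ P0 rfl (fun w hw => hw)
  have hcount : ∀ a b : Ω, (∑ y ∈ Y, permRep G Ω y (EuclideanSpace.single a 1)) b =
      ((Y.filter fun y => y • a = b).card : ℂ) := fun a b => by
    simp only [permRep_single]
    rw [Finset.card_filter]
    push_cast
    simp [Pi.single_apply, eq_comm]
  have hindep : ∀ a a' b : Ω, (Y.filter fun y => y • a = b).card =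
      (Y.filter fun y => y • a' = b).card := fun a a' b => by
    have := hk (EuclideanSpace.single a 1 - EuclideanSpace.single a' 1) (by
      change ∑ ω, _ = _
      simp [Finset.sum_sub_distrib])
    simp only [map_sub, Finset.sum_sub_distrib] at this
    have h2 := congrArg (fun v => v b) (sub_eq_zero.1 this)
    simp only [hcount] at h2
    exact_mod_cast h2
  obtain ⟨a0⟩ := ‹Nonempty Ω›
  have hmul : ∀ a b : Ω, Fintype.card Ω * (Y.filter fun y => y • a = b).card = Y.card := by
    intro a b
    have e : ∑ a' : Ω, (Y.filter fun y => y • a' = b).card = Y.card := by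
      rw [Finset.card_eq_sum_card_fiberwise (f := fun y : G => y⁻¹ • b) (t := Finset.univ)
        (fun _ _ => by simp)]
      refine Finset.sum_congr rfl fun a' _ => ?_
      congr 1
      ext y
      simp only [Finset.mem_filter, inv_smul_eq_iff, eq_comm (a := b)]
    rw [← e, Finset.sum_congr rfl fun a' _ => hindep a' a b]
    simp
  have hpos : 0 < Fintype.card Ω := Fintype.card_pos_iff.2 ⟨a0⟩
  refine ⟨(Y.filter fun y => y • a0 = a0).card, ?_, fun a b => ?_⟩
  · have := hmul a0 a0
    have h2 := hY.card_pos
    rw [← this] at h2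
    exact Nat.pos_of_mul_pos_left h2
  · exact Nat.eq_of_mul_eq_mul_left hpos ((hmul a b).trans (hmul a0 a0).symm)

end

end TransAux

/-- **Algebraic characterisation of transitive subsets.**
Let `G` be a finite group acting transitively on a finite nonempty set `Ω` and let `Y` be a
nonempty subset of `G`.  Then `Y` is transitive on `Ω` (there is a constant `c > 0` such that
every `a ∈ Ω` is mapped to every `b ∈ Ω` by exactly `c` elements of `Y`) if and only if
`∑_{x,y ∈ Y} χ(x⁻¹y) = 0` for every irreducible character `χ` of `G` (the character of a
simple finite-dimensional complex representation) which is not the trivial character and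
has nonzero inner product with the permutation character `ξ` of `G` on `Ω`. -/
theorem transitive_iff_char_sums_vanish {G Ω : Type} [Group G] [Fintype G] [Fintype Ω]
    [Nonempty Ω] [DecidableEq Ω] [MulAction G Ω]
    (htrans : MulAction.IsPretransitive G Ω)
    (ξ : G → ℂ)
    (hξ : ∀ g, ξ g = Fintype.card {ω : Ω // g • ω = ω})
    (Y : Finset G) (hY : Y.Nonempty) :
    (∃ c : ℕ, 0 < c ∧ ∀ a b : Ω, (Y.filter fun y => y • a = b).card = c) ↔
      (∀ V : FDRep ℂ G, Simple V → V.character ≠ (fun _ => 1) →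
        (1 / (Fintype.card G : ℂ)) * ∑ g : G, ξ g * star (V.character g) ≠ 0 →
        ∑ x ∈ Y, ∑ y ∈ Y, V.character (x⁻¹ * y) = 0) := by
  constructor
  · rintro ⟨c, -, hc⟩ V hV h1 h2
    obtain ⟨f, hf⟩ := (TransAux.inner_ne_zero_iff (Ω := Ω) ξ hξ V.ρ).1 h2
    exact TransAux.forward Y c hc V hV h1 f hf
  · exact TransAux.backward htrans ξ hξ Y hY
end

section
/- Let G be a nontrivial finite abelian group, n ≥ 1, and let (σ,ρ) and (τ,π) be double partitions of n satisfying (σ,ρ) ≽_G (τ,π). Then: (a) ρ ⊴ π, (b) σ' ⊵ τ' (where λ' denotes the conjugate partition), and (c) σ∪ρ ⊴ τ∪π. -/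
/-- The monoid hom `Perm (Fin n) →* MulAut (Fin n → G)`, permuting coordinates. -/
def permMulAut (G : Type*) [CommGroup G] (n : ℕ) :
    Equiv.Perm (Fin n) →* MulAut (Fin n → G) where
  toFun π := MulEquiv.arrowCongr π (MulEquiv.refl G)
  map_one' := by ext f a; rfl
  map_mul' := by intro π σ; ext f a; rfl

/-- The wreath product `G ≀ Sₙ`. -/
abbrev Wr (G : Type*) [CommGroup G] (n : ℕ) :=
  SemidirectProduct (Fin n → G) (Equiv.Perm (Fin n)) (permMulAut G n)

/-- The natural action of `G ≀ Sₙ` on `G × [n]`. -/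
def wAct {G : Type*} [CommGroup G] {n : ℕ} (w : Wr G n) (p : G × Fin n) : G × Fin n :=
  (p.1 * w.left (w.right p.2), w.right p.2)

/-- The `i`-th largest part of a multiset of naturals (0-indexed; `0` beyond the last part). -/
def dparts (s : Multiset ℕ) (i : ℕ) : ℕ := ((s.sort (· ≤ ·)).reverse).getD i 0

/-- `s` is dominated by `t`. -/
def msDom (s t : Multiset ℕ) : Prop :=
  ∀ k, (((s.sort (· ≤ ·)).reverse).take k).sum ≤ (((t.sort (· ≤ ·)).reverse).take k).sum

/-- `T` is a `(σ,ρ)`-tabloid: the first component assigns to each element of `[n]` a block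
(`Sum.inl i` is the block of the `i+1`-st largest part of `σ`, `Sum.inr j` that of `ρ`),
blocks have the prescribed sizes, and the colouring (second component)
is normalised to `1` on the `ρ`-blocks. -/
def IsTabloid (G : Type*) [CommGroup G] (n : ℕ) (σ ρ : Multiset ℕ)
    (T : (Fin n → ℕ ⊕ ℕ) × (Fin n → G)) : Prop :=
  (∀ i, Nat.card {a : Fin n // T.1 a = Sum.inl i} = dparts σ i) ∧
  (∀ j, Nat.card {a : Fin n // T.1 a = Sum.inr j} = dparts ρ j) ∧
  (∀ a j, T.1 a = Sum.inr j → T.2 a = 1)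

/-- The action of the wreath product on (raw) tabloids. -/
def tabAct {G : Type*} [CommGroup G] {n : ℕ} (w : Wr G n)
    (T : (Fin n → ℕ ⊕ ℕ) × (Fin n → G)) : (Fin n → ℕ ⊕ ℕ) × (Fin n → G) :=
  ⟨fun a => T.1 (w.right⁻¹ a),
   fun a => match T.1 (w.right⁻¹ a) with
     | Sum.inl _ => T.2 (w.right⁻¹ a) * w.left a
     | Sum.inr _ => 1⟩

/-- A subset `Y` of `W` is transitive on `S ⊆ Ω` (w.r.t. an action `act`): there is a
constant `c > 0` such that any `a ∈ S` is mapped to any `b ∈ S` by exactly `c` elements of `Y`. -/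
def IsTransitiveOn {W Ω : Type*} (act : W → Ω → Ω) (S : Set Ω) (Y : Set W) : Prop :=
  ∃ c : ℕ, 0 < c ∧ ∀ a ∈ S, ∀ b ∈ S, Nat.card {y : W // y ∈ Y ∧ act y a = b} = c

/-- `Y ⊆ G ≀ Sₙ` is `(σ,ρ)`-transitive. -/
def DPTransitive (G : Type*) [CommGroup G] (n : ℕ) (σ ρ : Multiset ℕ)
    (Y : Set (Wr G n)) : Prop :=
  IsTransitiveOn tabAct {T | IsTabloid G n σ ρ T} Y

/-- `(σ,ρ) ≽_G (τ,π)` : every `(σ,ρ)`-transitive subset of `G ≀ Sₙ` is `(τ,π)`-transitive. -/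
def DPDom (G : Type*) [CommGroup G] (n : ℕ) (σ ρ τ π : Multiset ℕ) : Prop :=
  ∀ Y : Set (Wr G n), DPTransitive G n σ ρ Y → DPTransitive G n τ π Y

/-- The partition obtained by adding `k` to the `r`-th largest part (1-indexed). -/
def addPart (s : Multiset ℕ) (r k : ℕ) : Multiset ℕ :=
  s.erase (dparts s (r - 1)) + {dparts s (r - 1) + k}

/-! ### Multiset and list facts -/

lemma sum_range_getD (L : List ℕ) (f : ℕ → ℕ) (hf : f 0 = 0) (m : ℕ) (hm : L.length ≤ m) :
    ∑ i ∈ Finset.range m, f (L.getD i 0) = (L.map f).sum := by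
  induction L generalizing m with
  | nil => simp [hf]
  | cons x L ih =>
    obtain ⟨m, rfl⟩ : ∃ m', m = m' + 1 := ⟨m - 1, by simp at hm; omega⟩
    rw [Finset.sum_range_succ']
    simp only [List.getD_cons_succ, List.getD_cons_zero, List.map_cons, List.sum_cons]
    rw [ih m (by simpa using hm)]
    omega

lemma sum_range_take (L : List ℕ) (k : ℕ) :
    ∑ i ∈ Finset.range k, L.getD i 0 = (L.take k).sum := by
  induction L generalizing k with
  | nil => simp
  | cons x L ih =>
    cases k with
    | zero => simp
    | succ k =>
      rw [Finset.sum_range_succ']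
      simp only [List.getD_cons_succ, List.getD_cons_zero, List.take_succ_cons, List.sum_cons]
      rw [ih k]; omega

lemma sum_min_le_take (L : List ℕ) (hL : L.Pairwise (· ≥ ·)) (k N : ℕ) :
    ∑ c ∈ Finset.range N, min k (L.countP (fun x => decide (c < x))) ≤ (L.take k).sum := by
  induction L generalizing k with
  | nil => simp
  | cons x L ih =>
    cases k with
    | zero => simp
    | succ k =>
      rw [List.pairwise_cons] at hL
      have h1 : ∀ c ∈ Finset.range N,
          min (k+1) ((x :: L).countP (fun x => decide (c < x))) ≤
          (if c < x then 1 else 0) + min k (L.countP (fun x => decide (c < x))) := by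
        intro c _
        by_cases hc : c < x
        · simp [hc]
        · have : L.countP (fun x => decide (c < x)) = 0 := by
            rw [List.countP_eq_zero]
            intro a ha
            have := hL.1 a ha
            simp; omega
          simp [hc, this]
      refine (Finset.sum_le_sum h1).trans ?_
      rw [Finset.sum_add_distrib, List.take_succ_cons, List.sum_cons]
      refine Nat.add_le_add ?_ (ih hL.2 k)
      rw [← Finset.card_filter]
      calc _ ≤ (Finset.range x).card := Finset.card_le_card (by
              intro c; simp)
        _ = x := by simp

/-- the decreasing list of a multiset -/
def dlist (s : Multiset ℕ) : List ℕ := (s.sort (· ≤ ·)).reverse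

lemma coe_dlist (s : Multiset ℕ) : ((dlist s : List ℕ) : Multiset ℕ) = s := by
  simp [dlist]

lemma dlist_sorted (s : Multiset ℕ) : (dlist s).Pairwise (· ≥ ·) := by
  rw [dlist, List.pairwise_reverse]
  exact s.pairwise_sort (· ≤ ·)

lemma dlist_length (s : Multiset ℕ) : (dlist s).length = s.card := by
  conv_rhs => rw [← coe_dlist s]
  simp

/-- sum of the `k` largest parts -/
def topk (s : Multiset ℕ) (k : ℕ) : ℕ := ((dlist s).take k).sum

lemma sum_dparts (s : Multiset ℕ) (f : ℕ → ℕ) (hf : f 0 = 0) :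
    ∑ i ∈ Finset.range s.card, f (dparts s i) = (s.map f).sum := by
  have := sum_range_getD (dlist s) f hf s.card (dlist_length s).le
  conv_rhs => rw [← coe_dlist s]
  rw [Multiset.map_coe, Multiset.sum_coe, ← this]
  rfl

lemma dparts_lt (s : Multiset ℕ) (i : ℕ) (h : 0 < dparts s i) : i < s.card := by
  by_contra hc
  rw [← dlist_length] at hc
  have : dparts s i = 0 := List.getD_eq_default _ _ (not_lt.1 hc)
  omega

lemma card_dparts (s : Multiset ℕ) (c : ℕ) :
    ((Finset.range s.card).filter (fun i => c < dparts s i)).card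
      = (s.filter (fun x => c < x)).card := by
  rw [Finset.card_filter]
  rw [sum_dparts s (fun x => if c < x then 1 else 0) (by simp)]
  rw [← Multiset.countP_eq_card_filter]
  induction s using Multiset.induction with
  | empty => simp
  | cons a s ih => simp [Multiset.countP_cons, ih, add_comm]

lemma topk_eq (s : Multiset ℕ) (k : ℕ) : ∑ i ∈ Finset.range k, dparts s i = topk s k :=
  sum_range_take (dlist s) k

lemma sum_min_le_topk (s : Multiset ℕ) (k N : ℕ) :
    ∑ c ∈ Finset.range N, min k ((s.filter (fun x => c < x)).card) ≤ topk s k := by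
  have := sum_min_le_take (dlist s) (dlist_sorted s) k N
  refine le_trans (le_of_eq ?_) this
  refine Finset.sum_congr rfl fun c _ => ?_
  conv_lhs => rw [← coe_dlist s]
  rw [← Multiset.countP_eq_card_filter, Multiset.coe_countP]

lemma sum_eq_layers (t : Multiset ℕ) (N : ℕ) (hN : ∀ x ∈ t, x ≤ N) :
    t.sum = ∑ c ∈ Finset.range N, (t.filter (fun x => c < x)).card := by
  induction t using Multiset.induction with
  | empty => simp
  | cons a t ih =>
    rw [Multiset.sum_cons, ih (fun x hx => hN x (Multiset.mem_cons_of_mem hx))]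
    have : ∀ c, ((a ::ₘ t).filter (fun x => c < x)).card =
        (if c < a then 1 else 0) + (t.filter (fun x => c < x)).card := by
      intro c
      by_cases h : c < a <;> simp [h, add_comm]
    simp only [this]
    rw [Finset.sum_add_distrib, ← Finset.card_filter]
    congr 1
    have : (Finset.range N).filter (fun c => c < a) = Finset.range a := by
      ext c
      have := hN a (Multiset.mem_cons_self a t)
      simp; omega
    rw [this]; simp

lemma sum_le_topk (s t : Multiset ℕ) (h : t ≤ s) : t.sum ≤ topk s t.card := by
  rw [sum_eq_layers t t.sum (fun x hx => Multiset.le_sum_of_mem hx)]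
  refine le_trans (Finset.sum_le_sum fun c _ => ?_) (sum_min_le_topk s t.card t.sum)
  refine le_min (Multiset.card_le_card (Multiset.filter_le _ _)) ?_
  exact Multiset.card_le_card (Multiset.filter_le_filter _ h)

lemma topk_add_le (s t : Multiset ℕ) (k : ℕ) :
    ∃ k₁ k₂, k₁ + k₂ ≤ k ∧ topk (s + t) k ≤ topk s k₁ + topk t k₂ := by
  set u : Multiset ℕ := (((dlist (s + t)).take k : List ℕ) : Multiset ℕ) with hu
  have hus : u ≤ s + t := by
    conv_rhs => rw [← coe_dlist (s + t)]
    exact (List.take_sublist k _).subperm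
  have hcard : u.card ≤ k := by simp [hu]
  refine ⟨(u ∩ s).card, (u - s).card, ?_, ?_⟩
  · rw [← Multiset.card_add, add_comm, Multiset.sub_add_inter]; exact hcard
  · have h1 : topk (s + t) k = u.sum := by simp [topk, hu]
    rw [h1]
    conv_lhs => rw [← Multiset.sub_add_inter u s, Multiset.sum_add, add_comm]
    refine Nat.add_le_add (sum_le_topk _ _ (Multiset.inter_le_right)) (sum_le_topk _ _ ?_)
    rw [Multiset.sub_le_iff_le_add, add_comm]; exact hus

lemma sum_min_map (s : Multiset ℕ) (k : ℕ) :
    (s.map (fun x => min k x)).sum =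
      ∑ c ∈ Finset.range k, (s.filter (fun x => c + 1 ≤ x)).card := by
  induction s using Multiset.induction with
  | empty => simp
  | cons a t ih =>
    have : ∀ c, ((a ::ₘ t).filter (fun x => c + 1 ≤ x)).card =
        (if c + 1 ≤ a then 1 else 0) + (t.filter (fun x => c + 1 ≤ x)).card := by
      intro c
      by_cases h : c + 1 ≤ a
      · rw [Multiset.filter_cons_of_pos _ h, if_pos h, Multiset.card_cons, add_comm]
      · rw [Multiset.filter_cons_of_neg _ h, if_neg h, zero_add]
    simp only [this]
    rw [Finset.sum_add_distrib, ← Finset.card_filter, Multiset.map_cons, Multiset.sum_cons, ih]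
    congr 1
    have : (Finset.range k).filter (fun c => c + 1 ≤ a) = Finset.range (min k a) := by
      ext c
      simp only [Finset.mem_filter, Finset.mem_range]
      omega
    rw [this]; simp

/-- size of the block with a given index -/
def bsize (σ ρ : Multiset ℕ) : ℕ ⊕ ℕ → ℕ := Sum.elim (dparts σ) (dparts ρ)

/-- indices of potentially nonempty blocks -/
def brows (σ ρ : Multiset ℕ) : Finset (ℕ ⊕ ℕ) :=
  (Finset.range σ.card).disjSum (Finset.range ρ.card)

lemma mem_brows (σ ρ : Multiset ℕ) (x : ℕ ⊕ ℕ) (h : 0 < bsize σ ρ x) : x ∈ brows σ ρ := by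
  rcases x with i | j
  · simpa [brows] using dparts_lt σ i h
  · simpa [brows] using dparts_lt ρ j h

lemma exists_cells (n : ℕ) (σ ρ : Multiset ℕ) (hn : σ.sum + ρ.sum = n) :
    ∃ e : Fin n → (ℕ ⊕ ℕ) × ℕ, Function.Injective e ∧
      ∀ p, (∃ i, e i = p) ↔ p.2 < bsize σ ρ p.1 := by
  set C : Finset (Σ _ : ℕ ⊕ ℕ, ℕ) := (brows σ ρ).sigma (fun x => Finset.range (bsize σ ρ x))
    with hC
  have hcard : C.card = n := by
    rw [hC, Finset.card_sigma, brows, Finset.sum_disjSum]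
    simp only [bsize, Finset.card_range, Sum.elim_inl, Sum.elim_inr]
    rw [sum_dparts σ (fun x => x) rfl, sum_dparts ρ (fun x => x) rfl]
    simpa using hn
  let E := C.equivFinOfCardEq hcard
  refine ⟨fun i => (((E.symm i : C) : Σ _ : ℕ ⊕ ℕ, ℕ).1, ((E.symm i : C) : Σ _ : ℕ ⊕ ℕ, ℕ).2),
    ?_, ?_⟩
  · intro i j h
    simp only [Prod.mk.injEq] at h
    apply E.symm.injective
    apply Subtype.ext
    exact Sigma.ext h.1 (heq_of_eq h.2)
  · rintro ⟨x, c⟩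
    constructor
    · rintro ⟨i, hi⟩
      have h2 := (Finset.mem_sigma.1 (E.symm i).2).2
      simp only [Prod.mk.injEq] at hi
      rw [Finset.mem_range, hi.1, hi.2] at h2
      exact h2
    · intro h
      have hm : (⟨x, c⟩ : Σ _ : ℕ ⊕ ℕ, ℕ) ∈ C := by
        rw [hC, Finset.mem_sigma, Finset.mem_range]
        exact ⟨mem_brows _ _ _ (lt_of_le_of_lt (Nat.zero_le _) h), h⟩
      exact ⟨E ⟨_, hm⟩, by simp⟩

/-- Tabloids with trivial colouring from cells. -/
lemma tabloid_of_cells (G : Type) [CommGroup G] (n : ℕ) (σ ρ : Multiset ℕ)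
    (e : Fin n → (ℕ ⊕ ℕ) × ℕ) (he : Function.Injective e)
    (hs : ∀ p, (∃ i, e i = p) ↔ p.2 < bsize σ ρ p.1) :
    IsTabloid G n σ ρ (fun i => (e i).1, fun _ => 1) := by
  have key : ∀ x, Nat.card {a : Fin n // (e a).1 = x} = bsize σ ρ x := by
    intro x
    rw [← Nat.card_fin (bsize σ ρ x)]
    refine Nat.card_congr (Equiv.ofBijective
      (fun a => ⟨(e a.1).2, by have := (hs (e a.1)).1 ⟨_, rfl⟩; rwa [a.2] at this⟩) ⟨?_, ?_⟩)
    · rintro ⟨a, ha⟩ ⟨b, hb⟩ h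
      simp only [Fin.mk.injEq] at h
      apply Subtype.ext
      apply he
      exact Prod.ext (ha.trans hb.symm) h
    · rintro ⟨c, hc⟩
      obtain ⟨i, hi⟩ := (hs (x, c)).2 hc
      exact ⟨⟨i, by rw [hi]⟩, by simp [hi]⟩
  exact ⟨fun i => key (Sum.inl i), fun j => key (Sum.inr j), fun _ _ _ => rfl⟩
/-! ### The wreath product and its action -/

section wreath

variable {G : Type} [CommGroup G] {n : ℕ}

lemma wr_mul_left (w s : Wr G n) (i : Fin n) :
    (w * s).left i = w.left i * s.left (w.right⁻¹ i) := rfl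

lemma wr_mul_right (w s : Wr G n) : (w * s).right = w.right * s.right := rfl

lemma tabAct_mul (w s : Wr G n) (T : (Fin n → ℕ ⊕ ℕ) × (Fin n → G)) :
    tabAct (w * s) T = tabAct w (tabAct s T) := by
  have h : ∀ a, (w * s).right⁻¹ a = s.right⁻¹ (w.right⁻¹ a) := by
    intro a; rw [wr_mul_right, mul_inv_rev]; rfl
  refine Prod.ext ?_ ?_
  · funext a
    simp only [tabAct, h]
  · funext a
    simp only [tabAct, h, wr_mul_left]
    cases T.1 (s.right⁻¹ (w.right⁻¹ a)) with
    | inl x => simp only [mul_assoc]; rw [mul_comm (w.left a)]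
    | inr x => rfl

lemma tabAct_tabloid {σ ρ : Multiset ℕ} (w : Wr G n) {T : (Fin n → ℕ ⊕ ℕ) × (Fin n → G)}
    (hT : IsTabloid G n σ ρ T) : IsTabloid G n σ ρ (tabAct w T) := by
  have key : ∀ x, Nat.card {a : Fin n // (tabAct w T).1 a = x}
      = Nat.card {a : Fin n // T.1 a = x} := by
    intro x
    refine Nat.card_congr (w.right⁻¹.subtypeEquiv ?_)
    intro a; rfl
  refine ⟨fun i => (key _).trans (hT.1 i), fun i => (key _).trans (hT.2.1 i), ?_⟩
  intro a j h
  have h' : T.1 (w.right⁻¹ a) = Sum.inr j := h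
  simp only [tabAct, h']

lemma tabAct_one {σ ρ : Multiset ℕ} {T : (Fin n → ℕ ⊕ ℕ) × (Fin n → G)}
    (hT : IsTabloid G n σ ρ T) : tabAct 1 T = T := by
  refine Prod.ext rfl ?_
  funext a
  have h : (1 : Wr G n).right⁻¹ a = a := rfl
  have h2 : (1 : Wr G n).left a = 1 := rfl
  simp only [tabAct, h, h2]
  cases hx : T.1 a with
  | inl x => simp
  | inr x => exact (hT.2.2 a x hx).symm

lemma exists_move {σ ρ : Multiset ℕ} {S T : (Fin n → ℕ ⊕ ℕ) × (Fin n → G)}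
    (hS : IsTabloid G n σ ρ S) (hT : IsTabloid G n σ ρ T) : ∃ w : Wr G n, tabAct w S = T := by
  have key : ∀ x, Nonempty ({a : Fin n // S.1 a = x} ≃ {a : Fin n // T.1 a = x}) := by
    intro x
    rw [← Finite.card_eq]
    rcases x with x | x
    · exact (hS.1 x).trans (hT.1 x).symm
    · exact (hS.2.1 x).trans (hT.2.1 x).symm
  let p : Equiv.Perm (Fin n) := Equiv.ofFiberEquiv (fun x => (key x).some)
  have hp : ∀ a, T.1 (p a) = S.1 a := fun a => Equiv.ofFiberEquiv_map _ a
  refine ⟨⟨fun a => T.2 a * (S.2 (p⁻¹ a))⁻¹, p⟩, ?_⟩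
  have hp' : ∀ a, S.1 (p⁻¹ a) = T.1 a := by
    intro a
    rw [← hp]; simp
  refine Prod.ext ?_ ?_
  · funext a; exact hp' a
  · funext a
    simp only [tabAct, hp']
    cases hx : T.1 a with
    | inl x => simp
    | inr x => exact (hT.2.2 a x hx).symm

variable [Fintype G]

noncomputable instance wrFintype : Fintype (Wr G n) := by
  classical
  exact Fintype.ofEquiv _ (SemidirectProduct.equivProd (φ := permMulAut G n)).symm

open Classical in
/-- weighted number of group elements moving `a` to `b` -/
noncomputable def wsum (F : Wr G n → ℤ) (a b : (Fin n → ℕ ⊕ ℕ) × (Fin n → G)) : ℤ :=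
  ∑ w : Wr G n, if tabAct w a = b then F w else 0

lemma wsum_average {ι : Type} [Fintype ι] (F : Wr G n → ℤ)
    (a b : (Fin n → ℕ ⊕ ℕ) × (Fin n → G)) (s : ι → Wr G n) (hs : ∀ x, tabAct (s x) a = a)
    (q : ℤ) (hq : ∀ w, ∑ x, F (w * s x) = q) :
    (Fintype.card ι : ℤ) * wsum F a b = q * wsum (fun _ => 1) a b := by
  classical
  have h1 : ∀ x, wsum F a b = ∑ w : Wr G n, if tabAct w a = b then F (w * s x) else 0 := by
    intro x
    unfold wsum
    rw [← Equiv.sum_comp (Equiv.mulRight (s x))]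
    refine Finset.sum_congr rfl fun w _ => ?_
    simp only [Equiv.coe_mulRight, tabAct_mul, hs]
  calc (Fintype.card ι : ℤ) * wsum F a b = ∑ _x : ι, wsum F a b := by simp
    _ = ∑ x : ι, ∑ w : Wr G n, if tabAct w a = b then F (w * s x) else 0 :=
        Finset.sum_congr rfl fun x _ => h1 x
    _ = ∑ w : Wr G n, ∑ x : ι, if tabAct w a = b then F (w * s x) else 0 := Finset.sum_comm
    _ = ∑ w : Wr G n, q * (if tabAct w a = b then 1 else 0) := by
        refine Finset.sum_congr rfl fun w _ => ?_
        split_ifs <;> simp [hq]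
    _ = _ := by rw [← Finset.mul_sum]; rfl

lemma wsum_one_pos {σ ρ : Multiset ℕ} {a b : (Fin n → ℕ ⊕ ℕ) × (Fin n → G)}
    (ha : IsTabloid G n σ ρ a) (hb : IsTabloid G n σ ρ b) : 0 < wsum (fun _ => 1) a b := by
  classical
  obtain ⟨w, hw⟩ := exists_move ha hb
  unfold wsum
  refine Finset.sum_pos' (fun w _ => by split_ifs <;> simp) ⟨w, Finset.mem_univ _, by simp [hw]⟩

lemma wsum_one_const {σ ρ : Multiset ℕ} {a b a' b' : (Fin n → ℕ ⊕ ℕ) × (Fin n → G)}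
    (ha : IsTabloid G n σ ρ a) (hb : IsTabloid G n σ ρ b)
    (ha' : IsTabloid G n σ ρ a') (hb' : IsTabloid G n σ ρ b') :
    wsum (fun _ => 1) a b = wsum (fun _ => 1) a' b' := by
  classical
  obtain ⟨u, hu⟩ := exists_move ha' ha
  obtain ⟨v, hv⟩ := exists_move hb hb'
  unfold wsum
  rw [← Equiv.sum_comp ((Equiv.mulRight u).trans (Equiv.mulLeft v))
    (fun w => if tabAct w a' = b' then (1 : ℤ) else 0)]
  refine Finset.sum_congr rfl fun w _ => ?_
  have : tabAct ((Equiv.mulRight u).trans (Equiv.mulLeft v) w) a' = b' ↔ tabAct w a = b := by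
    simp only [Equiv.trans_apply, Equiv.coe_mulRight, Equiv.coe_mulLeft]
    rw [tabAct_mul, tabAct_mul, hu]
    constructor
    · intro h
      have h2 := congrArg (tabAct v⁻¹) (h.trans hv.symm)
      rw [← tabAct_mul v⁻¹ v (tabAct w a), ← tabAct_mul v⁻¹ v b, inv_mul_cancel, tabAct_one hb,
        tabAct_one (tabAct_tabloid w ha)] at h2
      exact h2
    · intro h; rw [h, hv]
  simp only [this]

lemma card_eq_wsum (F : Wr G n → ℤ) (hF : ∀ w, F w = 0 ∨ F w = 1)
    (a b : (Fin n → ℕ ⊕ ℕ) × (Fin n → G)) :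
    (Nat.card {y : Wr G n // y ∈ {w | F w = 1} ∧ tabAct y a = b} : ℤ) = wsum F a b := by
  classical
  rw [Nat.card_eq_fintype_card, Fintype.card_subtype, Finset.card_filter]
  push_cast
  unfold wsum
  refine Finset.sum_congr rfl fun w _ => ?_
  rcases hF w with h | h <;> simp [h]

lemma transitive_of_density {σ ρ : Multiset ℕ} (F : Wr G n → ℤ) (hF : ∀ w, F w = 0 ∨ F w = 1)
    (D q : ℤ) (hD : 0 < D) (hq : 0 < q)
    (h : ∀ a, IsTabloid G n σ ρ a → ∀ b, D * wsum F a b = q * wsum (fun _ => 1) a b) :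
    DPTransitive G n σ ρ {w | F w = 1} := by
  by_cases hne : ∃ a, IsTabloid G n σ ρ a
  · obtain ⟨a₀, h₀⟩ := hne
    refine ⟨Nat.card {y : Wr G n // y ∈ {w | F w = 1} ∧ tabAct y a₀ = a₀}, ?_,
      fun a ha b hb => ?_⟩
    · zify
      rw [card_eq_wsum F hF]
      have h1 := h a₀ h₀ a₀
      have h2 := mul_pos hq (wsum_one_pos h₀ h₀)
      rw [← h1] at h2
      exact pos_of_mul_pos_right h2 hD.le
    · zify
      rw [card_eq_wsum F hF, card_eq_wsum F hF]
      have h1 := h a₀ h₀ a₀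
      have h2 := h a ha b
      rw [wsum_one_const ha hb h₀ h₀, ← h1] at h2
      exact mul_left_cancel₀ hD.ne' h2
  · refine ⟨1, one_pos, fun a ha => (hne ⟨a, ha⟩).elim⟩

lemma sum_wsum (a : (Fin n → ℕ ⊕ ℕ) × (Fin n → G)) :
    ∃ s : Finset ((Fin n → ℕ ⊕ ℕ) × (Fin n → G)), (∀ b, b ∈ s ↔ ∃ w : Wr G n, tabAct w a = b) ∧
    ∀ F : Wr G n → ℤ, ∑ w, F w = ∑ b ∈ s, wsum F a b := by
  classical
  refine ⟨Finset.univ.image (fun w : Wr G n => tabAct w a), by simp, fun F => ?_⟩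
  unfold wsum
  rw [Finset.sum_comm]
  refine Finset.sum_congr rfl fun w _ => ?_
  rw [Finset.sum_ite_eq, if_pos (Finset.mem_image_of_mem _ (Finset.mem_univ _))]

/-- Core obstruction lemma. -/
lemma core_obstruction {σ ρ τ π : Multiset ℕ} (F f : Wr G n → ℤ)
    (hF : ∀ w, F w = 0 ∨ F w = 1) (hFf : ∀ w, F w - f w = 0 ∨ F w - f w = 1)
    (D q : ℤ) (hD : 0 < D) (hq : 0 < q)
    (h1 : ∀ a, IsTabloid G n σ ρ a → ∀ b, D * wsum F a b = q * wsum (fun _ => 1) a b)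
    (h2 : ∀ a, IsTabloid G n σ ρ a → ∀ b, wsum f a b = 0)
    (h3 : ∃ a, IsTabloid G n τ π a ∧ wsum f a a ≠ 0)
    (hne : ∃ a, IsTabloid G n σ ρ a) : ¬ DPDom G n σ ρ τ π := by
  classical
  intro hdom
  have hsub : ∀ a b, wsum (fun w => F w - f w) a b = wsum F a b - wsum f a b := by
    intro a b
    unfold wsum
    rw [← Finset.sum_sub_distrib]
    refine Finset.sum_congr rfl fun w _ => ?_
    split_ifs <;> simp
  obtain ⟨c₁, -, t1⟩ := hdom _ (transitive_of_density F hF D q hD hq h1)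
  obtain ⟨c₂, -, t2⟩ := hdom _ (transitive_of_density (fun w => F w - f w) hFf D q hD hq
    (fun a ha b => by rw [hsub, h2 a ha b, sub_zero, h1 a ha b]))
  have hf0 : ∑ w, f w = 0 := by
    obtain ⟨a, ha⟩ := hne
    obtain ⟨s, -, hs⟩ := sum_wsum a
    rw [hs]
    exact Finset.sum_eq_zero fun b _ => h2 a ha b
  obtain ⟨a, ha, hfa⟩ := h3
  obtain ⟨s, hs, hsum⟩ := sum_wsum a
  have e1 : ∀ b ∈ s, wsum F a b = c₁ := by
    intro b hb
    obtain ⟨w, rfl⟩ := (hs b).1 hb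
    rw [← card_eq_wsum F hF]
    exact_mod_cast t1 a ha _ (tabAct_tabloid w ha)
  have e2 : ∀ b ∈ s, wsum (fun w => F w - f w) a b = c₂ := by
    intro b hb
    obtain ⟨w, rfl⟩ := (hs b).1 hb
    rw [← card_eq_wsum _ hFf]
    exact_mod_cast t2 a ha _ (tabAct_tabloid w ha)
  have has : a ∈ s := (hs a).2 ⟨1, tabAct_one ha⟩
  have s1 := hsum f
  rw [hf0] at s1
  have e3 : ∀ b ∈ s, wsum f a b = c₁ - c₂ := by
    intro b hb
    have := hsub a b
    rw [e1 b hb, e2 b hb] at this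
    linarith
  rw [Finset.sum_congr rfl e3, Finset.sum_const, nsmul_eq_mul] at s1
  have hs0 : (s.card : ℤ) ≠ 0 := by
    have := Finset.card_pos.2 ⟨a, has⟩
    omega
  apply hfa
  rw [e3 a has]
  rcases mul_eq_zero.1 s1.symm with h | h
  · exact (hs0 h).elim
  · exact h

end wreath
section constructions

variable {G : Type} [CommGroup G] {n : ℕ}

/-- product of all the colours -/
def zeta (w : Wr G n) : G := ∏ i, w.left i

lemma zeta_mul (w s : Wr G n) : zeta (w * s) = zeta w * zeta s := by
  unfold zeta
  simp only [wr_mul_left]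
  rw [Finset.prod_mul_distrib]
  congr 1
  exact Equiv.prod_comp w.right⁻¹ s.left

/-- sign of the underlying permutation -/
def wsgn (w : Wr G n) : ℤ := (Equiv.Perm.sign w.right : ℤ)

lemma wsgn_mul (w s : Wr G n) : wsgn (w * s) = wsgn w * wsgn s := by
  simp [wsgn]

lemma wsgn_cases (w : Wr G n) : wsgn w = 1 ∨ wsgn w = -1 := by
  unfold wsgn
  rcases Int.units_eq_one_or (Equiv.Perm.sign w.right) with h | h <;> simp [h]

/-- column-preserving subgroup with colours supported on the `α`-columns -/
def colSub (G : Type) [CommGroup G] {n : ℕ} {C : Type} (col : Fin n → C) (α : C → Prop) :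
    Subgroup (Wr G n) where
  carrier := {w | (∀ i, ¬ α (col i) → w.left i = 1) ∧ ∀ i, col (w.right i) = col i}
  one_mem' := ⟨fun _ _ => rfl, fun _ => rfl⟩
  mul_mem' := by
    rintro w s ⟨hw1, hw2⟩ ⟨hs1, hs2⟩
    refine ⟨fun i hi => ?_, fun i => ?_⟩
    · rw [wr_mul_left, hw1 i hi, one_mul]
      apply hs1
      have := hw2 (w.right⁻¹ i)
      rw [← Equiv.Perm.mul_apply, mul_inv_cancel, Equiv.Perm.one_apply] at this
      rwa [← this]
    · rw [wr_mul_right, Equiv.Perm.mul_apply, hw2, hs2]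
  inv_mem' := by
    rintro w ⟨hw1, hw2⟩
    refine ⟨fun i hi => ?_, fun i => ?_⟩
    · have : (w⁻¹).left i = (w.left (w.right i))⁻¹ := rfl
      rw [this, hw1, inv_one]
      rwa [hw2]
    · rw [SemidirectProduct.inv_right]
      have := hw2 (w.right⁻¹ i)
      rw [← Equiv.Perm.mul_apply, mul_inv_cancel, Equiv.Perm.one_apply] at this
      exact this.symm

/-- single colour element -/
def single (i : Fin n) (g : G) : Wr G n := ⟨Pi.mulSingle i g, 1⟩

lemma zeta_single (i : Fin n) (g : G) : zeta (single i g) = g := by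
  simp [zeta, single]

lemma wsgn_single (i : Fin n) (g : G) : wsgn (single i g) = 1 := by
  simp [wsgn, single]

lemma single_fix {σ ρ : Multiset ℕ} {a : (Fin n → ℕ ⊕ ℕ) × (Fin n → G)}
    (ha : IsTabloid G n σ ρ a) (i : Fin n) (r : ℕ) (hi : a.1 i = Sum.inr r) (g : G) :
    tabAct (single i g) a = a := by
  refine Prod.ext rfl ?_
  funext k
  have h : (single i g).right⁻¹ k = k := rfl
  simp only [tabAct, h]
  cases hx : a.1 k with
  | inl x =>
    have : k ≠ i := by rintro rfl; rw [hi] at hx; cases hx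
    simp [single, this]
  | inr x => exact (ha.2.2 k x hx).symm

/-- twisted transposition -/
def tswap (a : (Fin n → ℕ ⊕ ℕ) × (Fin n → G)) (i j : Fin n) : Wr G n :=
  ⟨fun k => a.2 k * (a.2 (Equiv.swap i j k))⁻¹, Equiv.swap i j⟩

lemma zeta_tswap (a : (Fin n → ℕ ⊕ ℕ) × (Fin n → G)) (i j : Fin n) : zeta (tswap a i j) = 1 := by
  simp only [zeta, tswap]
  rw [Finset.prod_mul_distrib, Finset.prod_inv_distrib, Equiv.prod_comp (Equiv.swap i j) a.2]
  simp

lemma wsgn_tswap (a : (Fin n → ℕ ⊕ ℕ) × (Fin n → G)) {i j : Fin n} (h : i ≠ j) :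
    wsgn (tswap a i j) = -1 := by
  simp [wsgn, tswap, Equiv.Perm.sign_swap h]

lemma apply_swap_eq {β : Type} (f : Fin n → β) {i j : Fin n} (h : f i = f j) (k : Fin n) :
    f (Equiv.swap i j k) = f k := by
  rcases eq_or_ne k i with rfl | hi
  · simp [h]
  · rcases eq_or_ne k j with rfl | hj
    · simp [h]
    · rw [Equiv.swap_apply_of_ne_of_ne hi hj]

lemma tswap_fix {σ ρ : Multiset ℕ} {a : (Fin n → ℕ ⊕ ℕ) × (Fin n → G)}
    (ha : IsTabloid G n σ ρ a) {i j : Fin n} (h : a.1 i = a.1 j) :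
    tabAct (tswap a i j) a = a := by
  have h1 : ∀ k, a.1 ((tswap a i j).right⁻¹ k) = a.1 k := by
    intro k
    simp only [tswap, Equiv.swap_inv]
    exact apply_swap_eq a.1 h k
  refine Prod.ext (funext h1) ?_
  funext k
  simp only [tabAct, h1]
  cases hx : a.1 k with
  | inl x => simp [tswap]
  | inr x => exact (ha.2.2 k x hx).symm

lemma tswap_mem {σ ρ : Multiset ℕ} {a : (Fin n → ℕ ⊕ ℕ) × (Fin n → G)}
    (ha : IsTabloid G n σ ρ a) {i j : Fin n} (h : a.1 i = a.1 j)
    {C : Type} (col : Fin n → C) (α : C → Prop) (hc : col i = col j)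
    (hα : α (col i) ∨ ∃ r, a.1 i = Sum.inr r) : tswap a i j ∈ colSub G col α := by
  refine ⟨fun k hk => ?_, fun k => apply_swap_eq col hc k⟩
  simp only [tswap]
  rcases hα with hα | ⟨r, hr⟩
  · have hi : k ≠ i := by rintro rfl; exact hk hα
    have hj : k ≠ j := by rintro rfl; rw [hc] at hα; exact hk hα
    rw [Equiv.swap_apply_of_ne_of_ne hi hj, mul_inv_cancel]
  · have : a.2 i = a.2 j := by rw [ha.2.2 i r hr, ha.2.2 j r (h ▸ hr)]
    rw [apply_swap_eq a.2 this, mul_inv_cancel]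

lemma single_mem (i : Fin n) (g : G) {C : Type} (col : Fin n → C) (α : C → Prop)
    (hα : α (col i)) : single i g ∈ colSub G col α := by
  refine ⟨fun k hk => ?_, fun k => rfl⟩
  have hi : k ≠ i := by rintro rfl; exact hk hα
  simp [single, hi]

open Classical in
/-- The signed function supported on the column subgroup. -/
noncomputable def colFun {C : Type} (col : Fin n → C) (α : C → Prop) (v : G → ℤ) (w : Wr G n) : ℤ :=
  if w ∈ colSub G col α then v (zeta w) * wsgn w else 0

lemma colFun_mul {C : Type} (col : Fin n → C) (α : C → Prop) (v : G → ℤ) (w s : Wr G n)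
    (hs : s ∈ colSub G col α) :
    colFun col α v (w * s) = colFun col α (fun g => v (g * zeta s)) w * wsgn s := by
  unfold colFun
  by_cases h : w ∈ colSub G col α
  · rw [if_pos (mul_mem h hs), if_pos h, zeta_mul, wsgn_mul, mul_assoc]
  · rw [if_neg (fun h' => h ((Subgroup.mul_mem_cancel_right _ hs).1 h')), if_neg h, zero_mul]

lemma zeta_one : zeta (1 : Wr G n) = 1 := by simp [zeta]

lemma wsgn_one : wsgn (1 : Wr G n) = 1 := by simp [wsgn]

variable [Fintype G]

lemma kill_swap {σ ρ : Multiset ℕ} {a : (Fin n → ℕ ⊕ ℕ) × (Fin n → G)}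
    (ha : IsTabloid G n σ ρ a) {i j : Fin n} (hij : i ≠ j) (h : a.1 i = a.1 j)
    {C : Type} (col : Fin n → C) (α : C → Prop) (v : G → ℤ) (hc : col i = col j)
    (hα : α (col i) ∨ ∃ r, a.1 i = Sum.inr r) (b) : wsum (colFun col α v) a b = 0 := by
  have := wsum_average (colFun col α v) a b (fun x : Bool => if x then tswap a i j else 1)
    (by rintro (_ | _)
        · exact tabAct_one ha
        · exact tswap_fix ha h) 0 (by
      intro w
      have hm := tswap_mem ha h col α hc hα
      simp only [Fintype.sum_bool, if_true, Bool.false_eq_true, if_false,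
        colFun_mul _ _ _ w _ hm, zeta_tswap, wsgn_tswap a hij]
      rw [mul_one w]
      simp)
  simpa using this

lemma kill_single {σ ρ : Multiset ℕ} {a : (Fin n → ℕ ⊕ ℕ) × (Fin n → G)}
    (ha : IsTabloid G n σ ρ a) {i : Fin n} {r : ℕ} (h : a.1 i = Sum.inr r)
    {C : Type} (col : Fin n → C) (α : C → Prop) (v : G → ℤ) (hv : ∑ g, v g = 0)
    (hα : α (col i)) (b) : wsum (colFun col α v) a b = 0 := by
  have := wsum_average (colFun col α v) a b (fun g : G => single i g)
    (fun g => single_fix ha i r h g) 0 (by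
      intro w
      simp only [colFun_mul _ _ _ w _ (single_mem i _ col α hα), zeta_single, wsgn_single, mul_one]
      unfold colFun
      by_cases hw : w ∈ colSub G col α
      · simp only [if_pos hw]
        rw [← Finset.sum_mul]
        have := Equiv.sum_comp (Equiv.mulLeft (zeta w)) v
        simp only [Equiv.coe_mulLeft] at this
        rw [this, hv, zero_mul]
      · simp only [if_neg hw]; simp)
  rw [zero_mul] at this
  rcases mul_eq_zero.1 this with h0 | h0
  · have : (Fintype.card G : ℤ) ≠ 0 := by exact_mod_cast Fintype.card_ne_zero
    exact (this h0).elim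
  · exact h0

lemma density_swap {σ ρ : Multiset ℕ} {a : (Fin n → ℕ ⊕ ℕ) × (Fin n → G)}
    (ha : IsTabloid G n σ ρ a) {i j : Fin n} (hij : i ≠ j) (h : a.1 i = a.1 j)
    (P : G → ℤ → ℤ) (hP : ∀ g, P g 1 + P g (-1) = 1) (b) :
    2 * wsum (fun w => P (zeta w) (wsgn w)) a b = 1 * wsum (fun _ => 1) a b := by
  have := wsum_average (fun w => P (zeta w) (wsgn w)) a b
    (fun x : Bool => if x then tswap a i j else 1)
    (by rintro (_ | _)
        · exact tabAct_one ha
        · exact tswap_fix ha h) 1 (by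
      intro w
      simp only [Fintype.sum_bool, if_true, Bool.false_eq_true, if_false, mul_one,
        zeta_mul, wsgn_mul, zeta_tswap, wsgn_tswap a hij, zeta_one, wsgn_one]
      have := hP (zeta w)
      rcases wsgn_cases w with h | h <;> rw [h] <;> norm_num <;> linarith)
  simpa using this

lemma density_single {σ ρ : Multiset ℕ} {a : (Fin n → ℕ ⊕ ℕ) × (Fin n → G)}
    (ha : IsTabloid G n σ ρ a) {i : Fin n} {r : ℕ} (h : a.1 i = Sum.inr r)
    (P : G → ℤ → ℤ) (hP1 : ∑ g, P g 1 = 1) (hP2 : ∑ g, P g (-1) = 1) (b) :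
    (Fintype.card G : ℤ) * wsum (fun w => P (zeta w) (wsgn w)) a b
      = 1 * wsum (fun _ => 1) a b := by
  refine wsum_average (fun w => P (zeta w) (wsgn w)) a b (fun g : G => single i g)
    (fun g => single_fix ha i r h g) 1 (fun w => ?_)
  simp only [zeta_mul, wsgn_mul, zeta_single, wsgn_single, mul_one]
  have := Equiv.sum_comp (Equiv.mulLeft (zeta w)) (fun g => P g (wsgn w))
  simp only [Equiv.coe_mulLeft] at this
  rw [this]
  rcases wsgn_cases w with h | h <;> rw [h] <;> assumption

lemma nonvanish {σ ρ : Multiset ℕ} (rows : Fin n → ℕ ⊕ ℕ)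
    (ha : IsTabloid G n σ ρ (rows, fun _ => 1))
    {C : Type} (col : Fin n → C) (α : C → Prop) (v : G → ℤ)
    (hinj : ∀ i j, rows i = rows j → col i = col j → i = j)
    (hv1 : v 1 = 1)
    (hv : (∀ g, v g = 1) ∨ (∀ i, α (col i) → ∃ r, rows i = Sum.inl r)) :
    wsum (colFun col α v) (rows, fun _ => 1) (rows, fun _ => 1) ≠ 0 := by
  classical
  have hone : colFun col α v 1 = 1 := by
    have h1 : zeta (1 : Wr G n) = 1 := by simp [zeta]
    have h2 : wsgn (1 : Wr G n) = 1 := by simp [wsgn]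
    rw [colFun, if_pos (one_mem _), h1, h2, hv1, mul_one]
  apply ne_of_gt
  unfold wsum
  refine Finset.sum_pos' ?_ ⟨1, Finset.mem_univ _, by rw [if_pos (tabAct_one ha), hone]; norm_num⟩
  intro w _
  split_ifs with hw
  · unfold colFun
    split_ifs with hK
    · have hr : w.right = 1 := by
        ext i
        have h1 := congrFun (congrArg Prod.fst hw) (w.right i)
        simp only [tabAct] at h1
        rw [← Equiv.Perm.mul_apply, inv_mul_cancel, Equiv.Perm.one_apply] at h1
        rw [hinj _ _ h1.symm (hK.2 i)]
        rfl
      have hs : wsgn w = 1 := by simp [wsgn, hr]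
      have hvw : v (zeta w) = 1 := by
        rcases hv with hv | hv
        · exact hv _
        · have : zeta w = 1 := by
            unfold zeta
            refine Finset.prod_eq_one fun i _ => ?_
            by_cases hi : α (col i)
            · obtain ⟨r, hri⟩ := hv i hi
              have h1 := congrFun (congrArg Prod.snd hw) i
              have h2 : rows (w.right⁻¹ i) = Sum.inl r := by rw [hr]; simpa using hri
              simpa only [tabAct, h2, one_mul] using h1
            · exact hK.1 i hi
          rw [this, hv1]
      rw [hs, hvw]; norm_num
    · exact le_rfl
  · exact le_rfl

end constructions
section final

variable {G : Type} [CommGroup G] [Fintype G] {n : ℕ}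

lemma block_card {σ ρ : Multiset ℕ} {a : (Fin n → ℕ ⊕ ℕ) × (Fin n → G)}
    (ha : IsTabloid G n σ ρ a) (x : ℕ ⊕ ℕ) :
    (Finset.univ.filter (fun i => a.1 i = x)).card = bsize σ ρ x := by
  rw [← Fintype.card_subtype, ← Nat.card_eq_fintype_card]
  rcases x with x | x
  · exact ha.1 x
  · exact ha.2.1 x

lemma rows_card {σ ρ : Multiset ℕ} {a : (Fin n → ℕ ⊕ ℕ) × (Fin n → G)}
    (ha : IsTabloid G n σ ρ a) (k₁ k₂ : ℕ) :
    (Finset.univ.filter (fun i => a.1 i ∈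
      (Finset.range k₁).disjSum (Finset.range k₂))).card = topk σ k₁ + topk ρ k₂ := by
  rw [Finset.card_eq_sum_card_fiberwise (f := a.1)
    (t := (Finset.range k₁).disjSum (Finset.range k₂)) (by intro i hi; simpa using hi)]
  have : ∀ x ∈ (Finset.range k₁).disjSum (Finset.range k₂),
      ((Finset.univ.filter (fun i => a.1 i ∈
      (Finset.range k₁).disjSum (Finset.range k₂))).filter (fun i => a.1 i = x)).card
      = bsize σ ρ x := by
    intro x hx
    rw [← block_card ha x, Finset.filter_filter]
    congr 1
    ext i
    simp only [Finset.mem_filter, Finset.mem_univ, true_and]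
    constructor
    · exact fun h => h.2
    · rintro rfl; exact ⟨hx, rfl⟩
  rw [Finset.sum_congr rfl this, Finset.sum_disjSum, ← topk_eq, ← topk_eq]
  rfl

lemma count_le_topk (U : Finset (Fin n)) (S : Finset (ℕ ⊕ ℕ)) (k : ℕ) (hS : S.card ≤ k)
    (row : Fin n → ℕ ⊕ ℕ) (c : Fin n → ℕ) (s : Multiset ℕ) (hU : ∀ i ∈ U, row i ∈ S)
    (hinj : ∀ i ∈ U, ∀ j ∈ U, row i = row j → c i = c j → i = j)
    (hcol : ∀ d, (U.filter (fun i => c i = d)).card ≤ (s.filter (fun x => d < x)).card) :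
    U.card ≤ topk s k := by
  set N := U.sup c + 1 with hN
  refine le_trans ?_ (sum_min_le_topk s k N)
  rw [Finset.card_eq_sum_card_fiberwise (f := c) (t := Finset.range N) (by
    intro i hi
    simp only [Finset.coe_range, Set.mem_Iio, hN]
    exact Nat.lt_succ_of_le (Finset.le_sup (f := c) hi))]
  refine Finset.sum_le_sum fun d _ => le_min (le_trans ?_ hS) (hcol d)
  refine Finset.card_le_card_of_injOn row (fun i hi => ?_) ?_
  · simp only [Finset.coe_filter, Set.mem_ofPred_eq] at hi
    exact hU i hi.1
  · intro i hi j hj h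
    simp only [Finset.coe_filter, Set.mem_ofPred_eq] at hi hj
    exact hinj i hi.1 j hj.1 h (hi.2.trans hj.2.symm)

lemma col_card_le (σ ρ : Multiset ℕ) (e : Fin n → (ℕ ⊕ ℕ) × ℕ) (he : Function.Injective e)
    (hs : ∀ i, (e i).2 < bsize σ ρ (e i).1) (U : Finset (Fin n)) (d : ℕ) :
    (U.filter (fun i => (e i).2 = d)).card ≤ ((σ + ρ).filter (fun x => d < x)).card := by
  rw [Multiset.filter_add, Multiset.card_add, ← card_dparts, ← card_dparts, ← Finset.card_disjSum]
  refine Finset.card_le_card_of_injOn (fun i => (e i).1) (fun i hi => ?_) ?_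
  · simp only [Finset.coe_filter, Set.mem_ofPred_eq] at hi
    have h := hs i
    have hm := mem_brows σ ρ _ (lt_of_le_of_lt (Nat.zero_le _) h)
    rw [hi.2] at h
    show (e i).1 ∈ _
    cases hx : (e i).1 with
    | inl r => rw [hx] at h hm; simp [brows, bsize] at h hm ⊢; exact ⟨hm, h⟩
    | inr r => rw [hx] at h hm; simp [brows, bsize] at h hm ⊢; exact ⟨hm, h⟩
  · intro i hi j hj h
    simp only [Finset.coe_filter, Set.mem_ofPred_eq] at hi hj
    exact he (Prod.ext h (hi.2.trans hj.2.symm))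

lemma col_card_le_right (σ ρ : Multiset ℕ) (e : Fin n → (ℕ ⊕ ℕ) × ℕ) (he : Function.Injective e)
    (hs : ∀ i, (e i).2 < bsize σ ρ (e i).1) (U : Finset (Fin n))
    (hU : ∀ i ∈ U, ∃ r, (e i).1 = Sum.inr r) (d : ℕ) :
    (U.filter (fun i => (e i).2 = d)).card ≤ (ρ.filter (fun x => d < x)).card := by
  rw [← card_dparts, ← Finset.card_map (⟨Sum.inr, Sum.inr_injective⟩ : ℕ ↪ ℕ ⊕ ℕ)
    (s := (Finset.range ρ.card).filter _)]
  refine Finset.card_le_card_of_injOn (fun i => (e i).1) (fun i hi => ?_) ?_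
  · simp only [Finset.coe_filter, Set.mem_ofPred_eq] at hi
    have h := hs i
    have hm := mem_brows σ ρ _ (lt_of_le_of_lt (Nat.zero_le _) h)
    rw [hi.2] at h
    obtain ⟨r, hx⟩ := hU i hi.1
    show (e i).1 ∈ _
    rw [hx] at h hm ⊢
    simp [brows, bsize] at h hm ⊢
    exact ⟨hm, h⟩
  · intro i hi j hj h
    simp only [Finset.coe_filter, Set.mem_ofPred_eq] at hi hj
    exact he (Prod.ext h (hi.2.trans hj.2.symm))

lemma conj_count {σ ρ τ π : Multiset ℕ} {a : (Fin n → ℕ ⊕ ℕ) × (Fin n → G)}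
    (ha : IsTabloid G n σ ρ a) (e : Fin n → (ℕ ⊕ ℕ) × ℕ)
    (hs : ∀ p, (∃ i, e i = p) ↔ p.2 < bsize τ π p.1)
    (h1 : ∀ i r, (e i).1 = Sum.inl r → ∃ r', a.1 i = Sum.inl r')
    (h2 : ∀ i j r r', (e i).1 = Sum.inl r → (e j).1 = Sum.inl r' → (e i).2 = (e j).2 →
      a.1 i = a.1 j → i = j) (k : ℕ) :
    ∑ i ∈ Finset.range k, (τ.filter fun x => i + 1 ≤ x).card ≤
      ∑ i ∈ Finset.range k, (σ.filter fun x => i + 1 ≤ x).card := by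
  classical
  set V : Finset (Fin n) := Finset.univ.filter (fun i => (∃ r, (e i).1 = Sum.inl r) ∧ (e i).2 < k)
    with hV
  have hlow : ∑ i ∈ Finset.range k, (τ.filter fun x => i + 1 ≤ x).card ≤ V.card := by
    have : ∀ c ∈ Finset.range k, (τ.filter fun x => c + 1 ≤ x).card =
        ((Finset.range τ.card).filter (fun i => c < dparts τ i)).card := by
      intro c _
      rw [card_dparts]; rfl
    rw [Finset.sum_congr rfl this, ← Finset.card_sigma]
    refine Finset.card_le_card_of_surjOn
      (fun i => (⟨(e i).2, Sum.elim id id (e i).1⟩ : Σ _ : ℕ, ℕ)) ?_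
    rintro ⟨c, r⟩ h
    simp only [Finset.coe_sigma, Set.mem_sigma_iff, Finset.coe_range, Set.mem_Iio,
      Finset.coe_filter, Finset.mem_range, Set.mem_ofPred_eq] at h
    obtain ⟨i, hi⟩ := (hs (Sum.inl r, c)).2 h.2.2
    refine ⟨i, ?_, by simp [hi]⟩
    simp [hV, hi, h.1]
  refine hlow.trans ?_
  rw [← sum_min_map, ← sum_dparts σ (fun x => min k x) (by simp)]
  have hVa : ∀ i ∈ V, ∃ r', a.1 i = Sum.inl r' := by
    intro i hi
    simp only [hV, Finset.mem_filter, Finset.mem_univ, true_and] at hi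
    obtain ⟨⟨r, hr⟩, -⟩ := hi
    exact h1 i r hr
  rw [Finset.card_eq_sum_card_fiberwise (f := fun i => Sum.elim id id (a.1 i))
    (t := Finset.range σ.card) (by
      intro i hi
      obtain ⟨r, hr⟩ := hVa i hi
      have : 0 < bsize σ ρ (Sum.inl r) := by
        rw [← block_card ha, Finset.card_pos]
        exact ⟨i, by simp [hr]⟩
      simp only [hr, Sum.elim_inl, id, Finset.coe_range, Set.mem_Iio]
      exact dparts_lt σ r this)]
  have hfib : ∀ r i, i ∈ V.filter (fun i => Sum.elim id id (a.1 i) = r) →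
      i ∈ V ∧ a.1 i = Sum.inl r := by
    intro r i hi
    rw [Finset.mem_filter] at hi
    obtain ⟨r', hr'⟩ := hVa i hi.1
    refine ⟨hi.1, ?_⟩
    have := hi.2
    rw [hr'] at this ⊢
    simp at this
    rw [this]
  refine Finset.sum_le_sum fun r _ => le_min ?_ ?_
  · rw [← Finset.card_range k]
    refine Finset.card_le_card_of_injOn (fun i => (e i).2) (fun i hi => ?_) ?_
    · have := (hfib r i hi).1
      simp only [hV, Finset.mem_filter, Finset.mem_univ, true_and] at this
      simpa using this.2
    · intro i hi j hj h
      have hi' := hfib r i hi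
      have hj' := hfib r j hj
      have hi1 := hi'.1
      have hj1 := hj'.1
      simp only [hV, Finset.mem_filter, Finset.mem_univ, true_and] at hi1 hj1
      obtain ⟨⟨r1, e1⟩, -⟩ := hi1
      obtain ⟨⟨r2, e2⟩, -⟩ := hj1
      exact h2 i j r1 r2 e1 e2 h (hi'.2.trans hj'.2.symm)
  · have := block_card ha (Sum.inl r)
    refine le_trans (Finset.card_le_card ?_) this.le
    intro i hi
    simp [(hfib r i hi).2]

lemma obstruct {σ ρ τ π : Multiset ℕ} (P : G → ℤ → ℤ) (v : G → ℤ)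
    (hP : ∀ g s, P g s = 0 ∨ P g s = 1)
    (hPv : ∀ g s, s = 1 ∨ s = -1 → P g s - v g * s = 0 ∨ P g s - v g * s = 1)
    (D : ℤ) (hD : 0 < D)
    (h1 : ∀ a, IsTabloid G n σ ρ a → ∀ b,
      D * wsum (fun w => P (zeta w) (wsgn w)) a b = 1 * wsum (fun _ => 1) a b)
    {C : Type} (col : Fin n → C) (α : C → Prop)
    (h2 : ∀ a, IsTabloid G n σ ρ a → ∀ b, wsum (colFun col α v) a b = 0)
    (h3 : ∃ a, IsTabloid G n τ π a ∧ wsum (colFun col α v) a a ≠ 0)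
    (hne : ∃ a, IsTabloid G n σ ρ a) : ¬ DPDom G n σ ρ τ π := by
  refine core_obstruction (fun w => P (zeta w) (wsgn w)) (colFun col α v) (fun w => hP _ _)
    (fun w => ?_) D 1 hD one_pos h1 h2 h3 hne
  unfold colFun
  by_cases h : w ∈ colSub G col α
  · simp only [if_pos h]
    exact hPv _ _ (wsgn_cases w)
  · simp only [if_neg h, sub_zero]
    exact hP _ _

/-- part (c) -/
lemma part_c {σ ρ τ π : Multiset ℕ} (hn1 : σ.sum + ρ.sum = n) (hn2 : τ.sum + π.sum = n)
    (hdom : DPDom G n σ ρ τ π) (k : ℕ) : topk (σ + ρ) k ≤ topk (τ + π) k := by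
  classical
  by_contra hk
  obtain ⟨e₁, he₁, hs₁⟩ := exists_cells n σ ρ hn1
  obtain ⟨e, he, hs⟩ := exists_cells n τ π hn2
  have hconf : ∀ a : (Fin n → ℕ ⊕ ℕ) × (Fin n → G), IsTabloid G n σ ρ a →
      ∃ i j, i ≠ j ∧ a.1 i = a.1 j ∧ (e i).2 = (e j).2 := by
    intro a ha
    by_contra hc
    apply hk
    obtain ⟨k₁, k₂, hkk, hle⟩ := topk_add_le σ ρ k
    refine hle.trans ?_
    rw [← rows_card ha]
    refine count_le_topk _ ((Finset.range k₁).disjSum (Finset.range k₂)) k (by simpa using hkk)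
      a.1 (fun i => (e i).2) (τ + π) (fun i hi => by simpa using hi) ?_
      (fun d => col_card_le τ π e he (fun i => (hs (e i)).1 ⟨i, rfl⟩) _ d)
    intro i _ j _ h1 h2
    by_contra hij
    exact hc ⟨i, j, hij, h1, h2⟩
  refine obstruct (G := G) (fun _ s => if s = 1 then 1 else 0) (fun _ => 1) ?_ ?_ 2 (by norm_num) ?_
    (fun i => (e i).2) (fun _ => True) ?_ ?_ ⟨_, tabloid_of_cells G n σ ρ e₁ he₁ hs₁⟩ hdom
  · intro g s; split_ifs <;> simp
  · rintro g s (rfl | rfl) <;> norm_num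
  · intro a ha b
    obtain ⟨i, j, hij, h, -⟩ := hconf a ha
    exact density_swap ha hij h (fun _ s => if s = 1 then 1 else 0) (by intro g; norm_num) b
  · intro a ha b
    obtain ⟨i, j, hij, h, h'⟩ := hconf a ha
    exact kill_swap ha hij h _ _ _ h' (Or.inl trivial) b
  · refine ⟨_, tabloid_of_cells G n τ π e he hs, nonvanish _
      (tabloid_of_cells G n τ π e he hs) _ _ _ ?_ rfl (Or.inl fun _ => rfl)⟩
    intro i j h1 h2
    exact he (Prod.ext h1 h2)

open Classical in
/-- the difference of two point masses -/
noncomputable def vdiff (h : G) (g : G) : ℤ := (if g = 1 then 1 else 0) - (if g = h then 1 else 0)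

open Classical in
/-- the indicator used when `ρ` is nonempty -/
noncomputable def indA (h : G) (g : G) (s : ℤ) : ℤ :=
  if (g = 1 ∧ s = 1) ∨ (g = h ∧ s = -1) then 1 else 0

open Classical in
/-- the indicator used when `ρ` is empty -/
noncomputable def indB (g : G) (s : ℤ) : ℤ :=
  if (g = 1 ∧ s = 1) ∨ (g ≠ 1 ∧ s = -1) then 1 else 0

lemma vdiff_sum (h : G) : ∑ g, vdiff h g = 0 := by
  classical
  simp [vdiff, Finset.sum_sub_distrib]

lemma vdiff_one {h : G} (hh : h ≠ 1) : vdiff h 1 = 1 := by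
  simp [vdiff, hh.symm]

lemma obstructA {σ ρ τ π : Multiset ℕ} {h : G} (hh : h ≠ 1) (r : ℕ) (hr : 0 < dparts ρ r)
    {C : Type} (col : Fin n → C) (α : C → Prop)
    (h2 : ∀ a, IsTabloid G n σ ρ a → ∀ b, wsum (colFun col α (vdiff h)) a b = 0)
    (h3 : ∃ a, IsTabloid G n τ π a ∧ wsum (colFun col α (vdiff h)) a a ≠ 0)
    (hne : ∃ a, IsTabloid G n σ ρ a) : ¬ DPDom G n σ ρ τ π := by
  classical
  refine obstruct (indA h) (vdiff h) ?_ ?_ (Fintype.card G)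
    (by exact_mod_cast Fintype.card_pos) ?_ col α h2 h3 hne
  · intro g s; unfold indA; split_ifs <;> simp
  · rintro g s (rfl | rfl)
    · by_cases h1 : g = 1
      · subst h1; simp [indA, vdiff, hh.symm]
      · by_cases h2 : g = h <;> simp [indA, vdiff, h1, h2, hh]
    · by_cases h1 : g = 1
      · subst h1; simp [indA, vdiff, hh.symm]
      · by_cases h2 : g = h <;> simp [indA, vdiff, h1, h2, hh]
  · intro a ha b
    have : 0 < bsize σ ρ (Sum.inr r) := hr
    rw [← block_card ha, Finset.card_pos] at this
    obtain ⟨i, hi⟩ := this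
    refine density_single ha (i := i) (r := r) (by simpa using hi) (indA h) ?_ ?_ b
    · simp [indA]
    · simp [indA]

/-- part (a) -/
lemma part_a [Nontrivial G] {σ ρ τ π : Multiset ℕ} (hn1 : σ.sum + ρ.sum = n)
    (hn2 : τ.sum + π.sum = n)
    (hdom : DPDom G n σ ρ τ π) (k : ℕ) : topk ρ k ≤ topk π k := by
  classical
  by_contra hk
  obtain ⟨h, hh⟩ := exists_ne (1 : G)
  obtain ⟨e₁, he₁, hs₁⟩ := exists_cells n σ ρ hn1
  obtain ⟨e, he, hs⟩ := exists_cells n τ π hn2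
  obtain ⟨r₀, hr₀⟩ : ∃ r, 0 < dparts ρ r := by
    by_contra hc
    push Not at hc
    apply hk
    rw [← topk_eq, Finset.sum_eq_zero fun i _ => Nat.le_zero.1 (hc i)]
    exact Nat.zero_le _
  let col : Fin n → ℕ ⊕ Fin n := fun i => if (e i).1.isRight then Sum.inl (e i).2 else Sum.inr i
  let α : ℕ ⊕ Fin n → Prop := fun x => x.isRight = true
  have hα : ∀ i, α (col i) ↔ (e i).1.isRight = false := by
    intro i
    by_cases hi : (e i).1.isRight <;> simp [α, col, hi]
  refine obstructA hh r₀ hr₀ col α ?_ ?_ ⟨_, tabloid_of_cells G n σ ρ e₁ he₁ hs₁⟩ hdom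
  · intro a ha b
    by_cases hc1 : ∃ i r, a.1 i = Sum.inr r ∧ (e i).1.isRight = false
    · obtain ⟨i, r, hi, hi2⟩ := hc1
      exact kill_single ha hi col α _ (vdiff_sum h) ((hα i).2 hi2) b
    by_cases hc2 : ∃ i j r, i ≠ j ∧ a.1 i = Sum.inr r ∧ a.1 j = Sum.inr r ∧ (e i).2 = (e j).2
    · obtain ⟨i, j, r, hij, hi, hj, hc⟩ := hc2
      have hii : (e i).1.isRight = true := by
        by_contra hx; exact hc1 ⟨i, r, hi, by simpa using hx⟩
      have hjj : (e j).1.isRight = true := by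
        by_contra hx; exact hc1 ⟨j, r, hj, by simpa using hx⟩
      exact kill_swap ha hij (hi.trans hj.symm) col α _ (by simp [col, hii, hjj, hc])
        (Or.inr ⟨r, hi⟩) b
    exfalso
    apply hk
    have h0 : topk ρ k = topk σ 0 + topk ρ k := by simp [topk]
    rw [h0, ← rows_card ha]
    have hmem : ∀ i ∈ Finset.univ.filter (fun i => a.1 i ∈
      (Finset.range 0).disjSum (Finset.range k)), ∃ r, a.1 i = Sum.inr r := by
      intro i hi
      rw [Finset.mem_filter] at hi
      cases hx : a.1 i with
      | inl x => rw [hx] at hi; simp at hi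
      | inr x => exact ⟨x, rfl⟩
    refine count_le_topk _ ((Finset.range 0).disjSum (Finset.range k)) k (by simp)
      a.1 (fun i => (e i).2) π (fun i hi => by simpa using hi) ?_
      (fun d => col_card_le_right τ π e he (fun i => (hs (e i)).1 ⟨i, rfl⟩) _ ?_ d)
    · intro i hi j _ h1 h2
      obtain ⟨r, hr⟩ := hmem i hi
      by_contra hij
      exact hc2 ⟨i, j, r, hij, hr, h1 ▸ hr, h2⟩
    · intro i hi
      obtain ⟨r, hr⟩ := hmem i hi
      rw [← Sum.isRight_iff]
      by_contra hx
      exact hc1 ⟨i, r, hr, by simpa using hx⟩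
  · refine ⟨_, tabloid_of_cells G n τ π e he hs, nonvanish _
      (tabloid_of_cells G n τ π e he hs) _ _ _ ?_ (vdiff_one hh) (Or.inr fun i hi => ?_)⟩
    · intro i j h1 h2
      by_cases hi : (e i).1.isRight
      · have hj : (e j).1.isRight := by rw [← h1]; exact hi
        simp only [col, hi, hj, if_true, Sum.inl.injEq] at h2
        exact he (Prod.ext h1 h2)
      · have hj : ¬ (e j).1.isRight := by rw [← h1]; exact hi
        simpa [col, hi, hj] using h2
    · rw [hα] at hi
      rw [← Sum.isLeft_iff]
      simpa using hi

/-- part (b) -/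
lemma part_b [Nontrivial G] {σ ρ τ π : Multiset ℕ} (hn1 : σ.sum + ρ.sum = n)
    (hn2 : τ.sum + π.sum = n)
    (hdom : DPDom G n σ ρ τ π) (k : ℕ) :
    ∑ i ∈ Finset.range k, (τ.filter fun x => i + 1 ≤ x).card ≤
      ∑ i ∈ Finset.range k, (σ.filter fun x => i + 1 ≤ x).card := by
  classical
  by_contra hk
  obtain ⟨h, hh⟩ := exists_ne (1 : G)
  obtain ⟨e₁, he₁, hs₁⟩ := exists_cells n σ ρ hn1
  obtain ⟨e, he, hs⟩ := exists_cells n τ π hn2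
  let col : Fin n → ℕ ⊕ Fin n := fun i => if (e i).1.isLeft then Sum.inl (e i).2 else Sum.inr i
  let α : ℕ ⊕ Fin n → Prop := fun x => x.isLeft = true
  have hα : ∀ i, α (col i) ↔ (e i).1.isLeft = true := by
    intro i
    by_cases hi : (e i).1.isLeft <;> simp [α, col, hi]
  have hconf : ∀ a : (Fin n → ℕ ⊕ ℕ) × (Fin n → G), IsTabloid G n σ ρ a →
      (∃ i r, a.1 i = Sum.inr r ∧ α (col i)) ∨
      ∃ i j, i ≠ j ∧ a.1 i = a.1 j ∧ col i = col j ∧ α (col i) := by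
    intro a ha
    by_contra hc
    push Not at hc
    apply hk
    refine conj_count ha e hs ?_ ?_ k
    · intro i r hr
      cases hx : a.1 i with
      | inl x => exact ⟨x, rfl⟩
      | inr x => exact (hc.1 i x hx ((hα i).2 (by rw [hr]; rfl))).elim
    · intro i j r r' hr hr' hcol hrow
      by_contra hij
      exact hc.2 i j hij hrow (by simp [col, hr, hr', hcol]) ((hα i).2 (by rw [hr]; rfl))
  have h2 : ∀ a, IsTabloid G n σ ρ a → ∀ b, wsum (colFun col α (vdiff h)) a b = 0 := by
    intro a ha b
    rcases hconf a ha with ⟨i, r, hi, hi2⟩ | ⟨i, j, hij, h1, h2, h3⟩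
    · exact kill_single ha hi col α _ (vdiff_sum h) hi2 b
    · exact kill_swap ha hij h1 col α _ h2 (Or.inl h3) b
  have h3 : ∃ a, IsTabloid G n τ π a ∧ wsum (colFun col α (vdiff h)) a a ≠ 0 := by
    refine ⟨_, tabloid_of_cells G n τ π e he hs, nonvanish _
      (tabloid_of_cells G n τ π e he hs) _ _ _ ?_ (vdiff_one hh) (Or.inr fun i hi => ?_)⟩
    · intro i j h1 h2
      by_cases hi : (e i).1.isLeft
      · have hj : (e j).1.isLeft := by rw [← h1]; exact hi
        simp only [col, hi, hj, if_true, Sum.inl.injEq] at h2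
        exact he (Prod.ext h1 h2)
      · have hj : ¬ (e j).1.isLeft := by rw [← h1]; exact hi
        simpa [col, hi, hj] using h2
    · rw [hα] at hi
      rwa [← Sum.isLeft_iff]
  by_cases hρ : ∃ r, 0 < dparts ρ r
  · obtain ⟨r₀, hr₀⟩ := hρ
    exact obstructA hh r₀ hr₀ col α h2 h3 ⟨_, tabloid_of_cells G n σ ρ e₁ he₁ hs₁⟩ hdom
  · refine obstruct indB (vdiff h) ?_ ?_ 2 (by norm_num) ?_ col α h2 h3
      ⟨_, tabloid_of_cells G n σ ρ e₁ he₁ hs₁⟩ hdom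
    · intro g s; unfold indB; split_ifs <;> simp
    · rintro g s (rfl | rfl)
      · by_cases h1 : g = 1
        · subst h1; simp [indB, vdiff, hh.symm]
        · by_cases h2 : g = h <;> simp [indB, vdiff, h1, h2, hh]
      · by_cases h1 : g = 1
        · subst h1; simp [indB, vdiff, hh.symm]
        · by_cases h2 : g = h <;> simp [indB, vdiff, h1, h2, hh]
    · intro a ha b
      rcases hconf a ha with ⟨i, r, hi, hi2⟩ | ⟨i, j, hij, h1, h2, h3⟩
      · exfalso
        apply hρ
        refine ⟨r, ?_⟩
        have := block_card ha (Sum.inr r)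
        have h4 : 0 < bsize σ ρ (Sum.inr r) := by
          rw [← this, Finset.card_pos]
          exact ⟨i, by simp [hi]⟩
        exact h4
      · refine density_swap ha hij h1 indB (fun g => ?_) b
        by_cases hg : g = 1 <;> simp [indB, hg]

end final

/-- **Necessary conditions for the transitivity-implication relation `≽`.**
Let `G` be a nontrivial finite abelian group and let `(σ,ρ)` and `(τ,π)` be double
partitions of `n ≥ 1` with `(σ,ρ) ≽_G (τ,π)` (every `(σ,ρ)`-transitive subset of
`G ≀ Sₙ` is `(τ,π)`-transitive).  Then (a) `ρ ⊴ π`, (b) `σ' ⊵ τ'` (dominance of the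
conjugate partitions, expressed via the conjugate parts `λ'ᵢ = #{parts of λ that are ≥ i}`),
and (c) `σ ∪ ρ ⊴ τ ∪ π`. -/
theorem necessary_conditions (G : Type) [CommGroup G] [Fintype G] [Nontrivial G]
    (n : ℕ) (hn : 1 ≤ n) (σ ρ τ π : Multiset ℕ)
    (hσ0 : 0 ∉ σ) (hρ0 : 0 ∉ ρ) (hτ0 : 0 ∉ τ) (hπ0 : 0 ∉ π)
    (hn1 : σ.sum + ρ.sum = n) (hn2 : τ.sum + π.sum = n)
    (hdom : DPDom G n σ ρ τ π) :
    msDom ρ π ∧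
    (∀ k, ∑ i ∈ Finset.range k, (τ.filter fun x => i + 1 ≤ x).card ≤
          ∑ i ∈ Finset.range k, (σ.filter fun x => i + 1 ≤ x).card) ∧
    msDom (σ + ρ) (τ + π) := by
  exact ⟨fun k => part_a hn1 hn2 hdom k, fun k => part_b hn1 hn2 hdom k,
    fun k => part_c hn1 hn2 hdom k⟩
end
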